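/- arXiv:2411.18563 — 2 statements merged into one kernel-verified Lean document; each statement's English description precedes it below -/
import Mathlib

section
/- Fix ζ ∈ (0,1] and c > 0 with ξ := 1 − 2ζc² > 0, and let λ : ℕ → (0,∞) be a sequence with √n·λ(n) → c. Then for all sufficiently large n the following holds. Let y and z be labeled graphs on vertex set {1,…,n}, each of maximum degree at most λ(n)·n + √(λ(n)·n)·log n. Then there exists a coupling π of the random graphs P_{λ(n),ζ} y and P_{λ(n),ζ} z such that the expectation under π of the Hamming distance between them is at most (1 − ξ/n²)·dist(y,z), where dist denotes Hamming distance of edge sets. -/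
open Filter
open scoped BigOperators symmDiff Classical

noncomputable section

/-- Number of edges of a labeled simple graph on `Fin n`. -/
def edgeCount {n : ℕ} (G : SimpleGraph (Fin n)) : ℕ := Nat.card G.edgeSet

/-- Number of triangles of a labeled simple graph on `Fin n`. -/
def triCount {n : ℕ} (G : SimpleGraph (Fin n)) : ℕ :=
  Nat.card {s : Finset (Fin n) // G.IsNClique 3 s}

/-- Probability of the event `A` under the Erdős–Rényi random graph `G(n,p)`. -/
def erProb (n : ℕ) (p : ℝ) (A : Set (SimpleGraph (Fin n))) : ℝ :=
  ∑ G : SimpleGraph (Fin n),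
    if G ∈ A then p ^ edgeCount G * (1 - p) ^ (n.choose 2 - edgeCount G) else 0

/-- Conditional probability `P_p(A | B)` for `G(n,p)`. -/
def erCondProb (n : ℕ) (p : ℝ) (A B : Set (SimpleGraph (Fin n))) : ℝ :=
  erProb n p (A ∩ B) / erProb n p B

/-- Probability of the event `A` under the uniform random graph `G(n,m)`. -/
def gnmProb (n m : ℕ) (A : Set (SimpleGraph (Fin n))) : ℝ :=
  (Nat.card {G : SimpleGraph (Fin n) // edgeCount G = m ∧ G ∈ A} : ℝ) /
    ((n.choose 2).choose m : ℝ)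

/-- Expected number of triangles of `G(n,m)`. -/
def gnmExpTri (n m : ℕ) : ℝ :=
  (∑ G : SimpleGraph (Fin n), if edgeCount G = m then (triCount G : ℝ) else 0) /
    ((n.choose 2).choose m : ℝ)

/-- Gibbs weight `λ^{|G|} (1-ζ)^{X(G)}`. -/
def gibbsWeight {n : ℕ} (lam zeta : ℝ) (G : SimpleGraph (Fin n)) : ℝ :=
  lam ^ edgeCount G * (1 - zeta) ^ triCount G

/-- The partition function `Z(λ,ζ)`. -/
def Zfun (n : ℕ) (lam zeta : ℝ) : ℝ := ∑ G : SimpleGraph (Fin n), gibbsWeight lam zeta G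

/-- Probability of the event `A` under the Gibbs measure `μ_{λ,ζ}`. -/
def gibbsProb (n : ℕ) (lam zeta : ℝ) (A : Set (SimpleGraph (Fin n))) : ℝ :=
  (∑ G : SimpleGraph (Fin n), if G ∈ A then gibbsWeight lam zeta G else 0) / Zfun n lam zeta

/-- Expectation of `f` under the Gibbs measure `μ_{λ,ζ}`. -/
def gibbsExp (n : ℕ) (lam zeta : ℝ) (f : SimpleGraph (Fin n) → ℝ) : ℝ :=
  (∑ G : SimpleGraph (Fin n), f G * gibbsWeight lam zeta G) / Zfun n lam zeta

/-- Number of edges of `H` with both endpoints in `S`. -/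
def edgesIn {V : Type*} (H : SimpleGraph V) (S : Finset V) : ℕ :=
  Nat.card {e : Sym2 V // e ∈ H.edgeSet ∧ ∀ v ∈ e, v ∈ S}

/-- Weight `λ^{|S|} (1-ζ)^{|E(S)|}` of the measure `ν_{H,λ,ζ}`. -/
def nuWeight {V : Type*} (H : SimpleGraph V) (lam zeta : ℝ) (S : Finset V) : ℝ :=
  lam ^ S.card * (1 - zeta) ^ edgesIn H S

/-- The partition function `Ξ_H(λ,ζ)`. -/
def XiFun {V : Type*} [Fintype V] (H : SimpleGraph V) (lam zeta : ℝ) : ℝ :=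
  ∑ S : Finset V, nuWeight H lam zeta S

/-- The probability of `S` under `ν_{H,λ,ζ}`. -/
def nuProb {V : Type*} [Fintype V] (H : SimpleGraph V) (lam zeta : ℝ) (S : Finset V) : ℝ :=
  nuWeight H lam zeta S / XiFun H lam zeta

/-- `W` is the Lambert-W function on `[0,∞)`: for `x ≥ 0`, `W x` is the unique `w ≥ 0`
with `w·e^w = x`. -/
def IsLambertW (W : ℝ → ℝ) : Prop :=
  ∀ x : ℝ, 0 ≤ x → (0 ≤ W x ∧ W x * Real.exp (W x) = x ∧
    ∀ w : ℝ, 0 ≤ w → w * Real.exp w = x → w = W x)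

/-- `η* = (W(2/e)/(2/e))^{3/2}`. -/
def etaStar (W : ℝ → ℝ) : ℝ := (W (2 / Real.exp 1) / (2 / Real.exp 1)) ^ ((3 : ℝ) / 2)

/-- The condition `c < c̄(η)` where `c̄(η) = 1/√(e(1−η/η*))` for `η < η*` and `+∞` otherwise. -/
def LtCbar (W : ℝ → ℝ) (c η : ℝ) : Prop :=
  η < etaStar W → c < 1 / Real.sqrt (Real.exp 1 * (1 - η / etaStar W))

/-- The left-hand side of the equation defining `ζ(c,η)`, interpreted as `1` at `ζ = 0`. -/
def zetaLHS (W : ℝ → ℝ) (c zeta : ℝ) : ℝ :=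
  (1 - zeta) * (if zeta = 0 then 1 else
    (W (2 * zeta * c ^ 2) / (2 * zeta * c ^ 2)) ^ ((3 : ℝ) / 2))



/-- Degree of a vertex. -/
def degN {n : ℕ} (G : SimpleGraph (Fin n)) (v : Fin n) : ℕ := Nat.card (G.neighborSet v)

/-- Maximum degree. -/
def maxDegN {n : ℕ} (G : SimpleGraph (Fin n)) : ℕ := Finset.univ.sup (degN G)

/-- The number of triangles containing the pair `e` in the graph `y ∪ {e}`, i.e. the number
of common neighbours in `y` of the two endpoints of `e`. -/
def triAt {n : ℕ} (y : SimpleGraph (Fin n)) (e : Sym2 (Fin n)) : ℕ :=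
  Nat.card {w : Fin n // ∀ v ∈ e, y.Adj v w}

/-- The probability that the single-step Glauber dynamics `P_{λ,ζ}`, started at `y` and
having chosen the pair `e`, inserts the edge `e`. -/
def insProb {n : ℕ} (lam zeta : ℝ) (y : SimpleGraph (Fin n)) (e : Sym2 (Fin n)) : ℝ :=
  lam * (1 - zeta) ^ triAt y e / (1 + lam * (1 - zeta) ^ triAt y e)

/-- The transition probability `y → z` of the single-step Glauber dynamics `P_{λ,ζ}` on
labeled graphs on `n` vertices: a uniformly random vertex pair is resampled. -/
def glauberStep (n : ℕ) (lam zeta : ℝ) (y z : SimpleGraph (Fin n)) : ℝ :=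
  (1 / (n.choose 2 : ℝ)) *
    ∑ e ∈ Finset.univ.filter (fun e : Sym2 (Fin n) => ¬ e.IsDiag),
      ((if z = y ⊔ SimpleGraph.fromEdgeSet {e} then insProb lam zeta y e else 0) +
       (if z = y.deleteEdges {e} then 1 - insProb lam zeta y e else 0))

/-- Hamming distance between the edge sets of two graphs. -/
def graphHammingDist {n : ℕ} (y z : SimpleGraph (Fin n)) : ℕ :=
  Nat.card {e : Sym2 (Fin n) // Xor' (e ∈ y.edgeSet) (e ∈ z.edgeSet)}

/-- With `√n · λ(n) → c`, the product of `λ(n)` and the degree bound tends to `c²`. -/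
theorem tendsto_mul_degree_bound {lam : ℕ → ℝ} {c : ℝ} (hlam : ∀ n, 0 < lam n)
    (hlc : Tendsto (fun n : ℕ => Real.sqrt n * lam n) atTop (nhds c)) :
    Tendsto (fun n : ℕ => lam n * (lam n * n + Real.sqrt (lam n * n) * Real.log n))
      atTop (nhds (c ^ 2)) := by
  have hlog : Tendsto (fun n : ℕ => Real.log n / (n : ℝ) ^ (1 / 4 : ℝ)) atTop (nhds 0) :=
    ((isLittleO_log_rpow_atTop (r := 1 / 4) (by norm_num)).tendsto_div_nhds_zero).comp
      tendsto_natCast_atTop_atTop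
  have h := (hlc.pow 2).add ((hlc.mul (hlc.sqrt)).mul hlog)
  rw [mul_zero, add_zero] at h
  refine h.congr' ?_
  filter_upwards [eventually_gt_atTop 0] with n hn
  have hn' : (0 : ℝ) < n := by exact_mod_cast hn
  set t : ℝ := (n : ℝ) ^ (1 / 4 : ℝ) with ht
  have htpos : 0 < t := by positivity
  have ht4 : (n : ℝ) = t ^ 4 := by
    rw [ht, ← Real.rpow_natCast, ← Real.rpow_mul hn'.le]; norm_num
  have hsq : Real.sqrt n = t ^ 2 := by
    rw [ht4, show t ^ 4 = (t ^ 2) ^ 2 by ring, Real.sqrt_sq (by positivity)]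
  have h1 : Real.sqrt (t ^ 2 * lam n) = t * Real.sqrt (lam n) := by
    rw [Real.sqrt_mul (by positivity), Real.sqrt_sq htpos.le]
  have h2 : Real.sqrt (lam n * n) = t ^ 2 * Real.sqrt (lam n) := by
    rw [Real.sqrt_mul (hlam n).le, hsq, mul_comm]
  rw [hsq, h1, h2]
  generalize Real.log n = L
  rw [ht4]
  field_simp

theorem insProb_mem_Icc {n : ℕ} {lam zeta : ℝ} (hl : 0 ≤ lam) (hq0 : 0 ≤ 1 - zeta)
    (x : SimpleGraph (Fin n)) (e : Sym2 (Fin n)) :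
    0 ≤ insProb lam zeta x e ∧ insProb lam zeta x e ≤ 1 := by
  have h : 0 ≤ lam * (1 - zeta) ^ triAt x e := by positivity
  unfold insProb
  exact ⟨by positivity, (div_le_one (by positivity)).2 (by linarith)⟩

theorem abs_div_one_add_sub_le {a b : ℝ} (ha : 0 ≤ a) (hb : 0 ≤ b) :
    |a / (1 + a) - b / (1 + b)| ≤ |a - b| := by
  have h : a / (1 + a) - b / (1 + b) = (a - b) / ((1 + a) * (1 + b)) := by field_simp; ring
  rw [h, abs_div, abs_of_pos (by positivity : 0 < (1 + a) * (1 + b))]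
  exact div_le_self (abs_nonneg _) (by nlinarith [mul_nonneg ha hb])

theorem abs_pow_sub_pow_le_of_mem_Icc {q : ℝ} (hq0 : 0 ≤ q) (hq1 : q ≤ 1) (i j : ℕ) :
    |q ^ i - q ^ j| ≤ (1 - q) * |(i : ℝ) - j| := by
  wlog hij : i ≤ j generalizing i j
  · rw [abs_sub_comm, abs_sub_comm (i : ℝ)]
    exact this j i (by omega)
  obtain ⟨k, rfl⟩ := Nat.exists_eq_add_of_le hij
  have hk : 1 - q ^ k ≤ k * (1 - q) := by
    have := one_add_mul_le_pow (a := q - 1) (by linarith) k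
    rw [add_sub_cancel] at this
    linarith
  have hk0 : 0 ≤ 1 - q ^ k := sub_nonneg.2 (pow_le_one₀ hq0 hq1)
  have h1 : q ^ i ≤ 1 := pow_le_one₀ hq0 hq1
  have h2 : 0 ≤ q ^ i := pow_nonneg hq0 i
  have h3 : |(i : ℝ) - ((i + k : ℕ) : ℝ)| = k := by
    push_cast; rw [sub_add_cancel_left, abs_neg, abs_of_nonneg (Nat.cast_nonneg k)]
  rw [h3, pow_add, ← mul_one_sub, abs_of_nonneg (by positivity)]
  nlinarith

theorem abs_insProb_sub_le {n : ℕ} {lam zeta : ℝ} (hl : 0 ≤ lam) (hq0 : 0 ≤ 1 - zeta)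
    (hz0 : 0 ≤ zeta) (y z : SimpleGraph (Fin n)) (e : Sym2 (Fin n)) :
    |insProb lam zeta y e - insProb lam zeta z e| ≤
      lam * zeta * |(triAt y e : ℝ) - triAt z e| := by
  unfold insProb
  refine (abs_div_one_add_sub_le (by positivity) (by positivity)).trans ?_
  rw [← mul_sub, abs_mul, abs_of_nonneg hl, mul_assoc]
  have := abs_pow_sub_pow_le_of_mem_Icc hq0 (by linarith) (triAt y e) (triAt z e)
  rw [sub_sub_cancel] at this
  gcongr

theorem degN_le_maxDegN {n : ℕ} (G : SimpleGraph (Fin n)) (v : Fin n) :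
    degN G v ≤ maxDegN G :=
  Finset.le_sup (f := degN G) (Finset.mem_univ v)

theorem graphHammingDist_eq_card_symmDiff {n : ℕ} (y z : SimpleGraph (Fin n)) :
    graphHammingDist y z = (y.edgeFinset ∆ z.edgeFinset).card := by
  unfold graphHammingDist
  rw [Nat.card_eq_fintype_card, Fintype.card_subtype]
  congr 1
  ext e
  simp only [Finset.mem_filter, Finset.mem_univ, true_and, Finset.mem_symmDiff,
    SimpleGraph.mem_edgeFinset]
  rfl

/-- Vertices that are common neighbours of the pair `e` in exactly one of the two graphs. -/
def triDiff {n : ℕ} (y z : SimpleGraph (Fin n)) (e : Sym2 (Fin n)) : Finset (Fin n) :=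
  Finset.univ.filter fun w => Xor (∀ v ∈ e, y.Adj v w) (∀ v ∈ e, z.Adj v w)

theorem abs_triAt_sub_le {n : ℕ} (y z : SimpleGraph (Fin n)) (e : Sym2 (Fin n)) :
    |(triAt y e : ℝ) - triAt z e| ≤ (triDiff y z e).card := by
  have key : ∀ y z : SimpleGraph (Fin n), triAt y e ≤ triAt z e + (triDiff y z e).card := by
    intro y z
    simp only [triAt, Nat.card_eq_fintype_card, Fintype.card_subtype]
    refine (Finset.card_le_card ?_).trans (Finset.card_union_le _ _)
    intro w hw
    simp only [triDiff, Finset.mem_union, Finset.mem_filter, Finset.mem_univ, true_and,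
      xor_def] at hw ⊢
    tauto
  have hcomm : triDiff z y e = triDiff y z e := by
    ext w; simp [triDiff, _root_.xor_comm]
  have h1 : (triAt y e : ℝ) ≤ triAt z e + (triDiff y z e).card := by exact_mod_cast key y z
  have h2 : (triAt z e : ℝ) ≤ triAt y e + (triDiff y z e).card := by
    have := key z y
    rw [hcomm] at this
    exact_mod_cast this
  rw [abs_le]
  constructor <;> linarith

/-- Number of neighbours of `w` in those of the two graphs that contain the edge `uw`. -/
theorem card_filter_adj_le {n : ℕ} (y z : SimpleGraph (Fin n)) {M : ℕ}
    (hy : ∀ v, degN y v ≤ M) (hz : ∀ v, degN z v ≤ M) (u w : Fin n) (h : (y ∆ z).Adj w u) :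
    (Finset.univ.filter fun v =>
      (y.Adj u w ∧ y.Adj v w) ∨ (z.Adj u w ∧ z.Adj v w)).card ≤ M := by
  have hdeg : ∀ G : SimpleGraph (Fin n),
      (Finset.univ.filter fun v => G.Adj v w).card = degN G w := by
    intro G
    simp only [degN, Nat.card_eq_fintype_card, SimpleGraph.neighborSet]
    rw [← Set.toFinset_card]
    congr 1
    ext v
    simp [G.adj_comm]
  rw [symmDiff_def, SimpleGraph.sup_adj, SimpleGraph.sdiff_adj, SimpleGraph.sdiff_adj] at h
  rw [y.adj_comm w u, z.adj_comm w u] at h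
  rcases h with ⟨h1, h2⟩ | ⟨h1, h2⟩
  · simpa [h1, h2, hdeg] using hy w
  · simpa [h1, h2, hdeg] using hz w

theorem sum_card_triDiff_le {n : ℕ} (y z : SimpleGraph (Fin n)) {M : ℕ}
    (hy : ∀ v, degN y v ≤ M) (hz : ∀ v, degN z v ≤ M) :
    ∑ e : Sym2 (Fin n), (triDiff y z e).card ≤ 2 * M * graphHammingDist y z := by
  set A : Fin n → Fin n → Finset (Fin n) := fun w u => Finset.univ.filter fun v =>
      (y.Adj u w ∧ y.Adj v w) ∨ (z.Adj u w ∧ z.Adj v w) with hA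
  have hmaps : (Finset.univ.sigma (triDiff y z)) ⊆
      ((Finset.univ.sigma fun w => (y ∆ z).neighborFinset w).sigma fun p => A p.1 p.2).image
        fun t => ⟨s(t.1.2, t.2), t.1.1⟩ := by
    rintro ⟨e, w⟩ h
    induction e using Sym2.ind with | _ a b =>
    simp only [Finset.mem_sigma, Finset.mem_univ, true_and, triDiff, Finset.mem_filter,
      Sym2.mem_iff, forall_eq_or_imp, forall_eq] at h
    have hex : ∃ u v, s(u, v) = s(a, b) ∧ (y ∆ z).Adj w u ∧
        ((y.Adj u w ∧ y.Adj v w) ∨ (z.Adj u w ∧ z.Adj v w)) := by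
      have hs : ∀ x, (y ∆ z).Adj w x ↔ Xor (y.Adj x w) (z.Adj x w) := by
        intro x
        rw [symmDiff_def, SimpleGraph.sup_adj, SimpleGraph.sdiff_adj, SimpleGraph.sdiff_adj,
          y.adj_comm w x, z.adj_comm w x, xor_def]
      by_cases hab : (y ∆ z).Adj w a
      · refine ⟨a, b, rfl, hab, ?_⟩
        simp only [xor_def] at h
        tauto
      · refine ⟨b, a, Sym2.eq_swap, ?_⟩
        rw [hs] at hab ⊢
        simp only [xor_def] at h hab ⊢
        tauto
    obtain ⟨u, v, huv, h1, h2⟩ := hex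
    refine Finset.mem_image.2 ⟨⟨⟨w, u⟩, v⟩, ?_, ?_⟩
    · simp only [Finset.mem_sigma, Finset.mem_univ, true_and, SimpleGraph.mem_neighborFinset, hA,
        Finset.mem_filter]
      exact ⟨h1, h2⟩
    · simp [huv]
  have hedges : (y ∆ z).edgeFinset.card = graphHammingDist y z := by
    rw [graphHammingDist_eq_card_symmDiff]
    congr 1
    ext e
    induction e using Sym2.ind
    rw [SimpleGraph.mem_edgeFinset, Finset.mem_symmDiff]
    simp [symmDiff_def]
  calc ∑ e : Sym2 (Fin n), (triDiff y z e).card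
      = (Finset.univ.sigma (triDiff y z)).card := (Finset.card_sigma _ _).symm
    _ ≤ _ := (Finset.card_le_card hmaps).trans Finset.card_image_le
    _ = ∑ p ∈ Finset.univ.sigma fun w => (y ∆ z).neighborFinset w, (A p.1 p.2).card :=
        Finset.card_sigma _ _
    _ ≤ ∑ p ∈ Finset.univ.sigma fun w => (y ∆ z).neighborFinset w, M := by
        refine Finset.sum_le_sum fun p hp => ?_
        simp only [Finset.mem_sigma, SimpleGraph.mem_neighborFinset] at hp
        exact card_filter_adj_le y z hy hz p.2 p.1 hp.2
    _ = (∑ w, (y ∆ z).degree w) * M := by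
        rw [Finset.sum_const, Finset.card_sigma, smul_eq_mul]
        rfl
    _ = 2 * M * graphHammingDist y z := by
        rw [SimpleGraph.sum_degrees_eq_twice_card_edges, ← hedges]; ring

theorem sum_abs_triAt_sub_le {n : ℕ} (y z : SimpleGraph (Fin n)) {B : ℝ}
    (hy : (maxDegN y : ℝ) ≤ B) (hz : (maxDegN z : ℝ) ≤ B) :
    ∑ e ∈ Finset.univ.filter (fun e : Sym2 (Fin n) => ¬ e.IsDiag),
      |(triAt y e : ℝ) - triAt z e| ≤ 2 * B * graphHammingDist y z := by
  have h := sum_card_triDiff_le y z (M := max (maxDegN y) (maxDegN z))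
    (fun v => (degN_le_maxDegN y v).trans (le_max_left _ _))
    (fun v => (degN_le_maxDegN z v).trans (le_max_right _ _))
  have hM : ((max (maxDegN y) (maxDegN z) : ℕ) : ℝ) ≤ B := by
    rw [Nat.cast_max]; exact max_le hy hz
  calc _ ≤ ∑ e : Sym2 (Fin n), ((triDiff y z e).card : ℝ) :=
        (Finset.sum_le_sum fun e _ => abs_triAt_sub_le y z e).trans
          (Finset.sum_le_sum_of_subset_of_nonneg (Finset.subset_univ _)
            fun _ _ _ => Nat.cast_nonneg _)
    _ ≤ 2 * ((max (maxDegN y) (maxDegN z) : ℕ) : ℝ) * graphHammingDist y z := by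
        exact_mod_cast h
    _ ≤ _ := by gcongr

/-- The graph obtained from `y` by setting the status of the pair `e`. -/
def setPair {n : ℕ} (y : SimpleGraph (Fin n)) (e : Sym2 (Fin n)) (b : Bool) :
    SimpleGraph (Fin n) :=
  if b then y ⊔ SimpleGraph.fromEdgeSet {e} else y.deleteEdges {e}

/-- The maximal coupling of two Bernoulli variables with parameters `p` and `q`. -/
def bernoulliCoupling (p q : ℝ) : Bool → Bool → ℝ
  | true, true => min p q
  | true, false => p - min p q
  | false, true => q - min p q
  | false, false => 1 - max p q

/-- The coupling of one Glauber step from `y` and one from `z` that resamples the same pair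
in both graphs and couples the two insertions maximally. -/
def glauberCoupling {n : ℕ} (lam zeta : ℝ) (y z a b : SimpleGraph (Fin n)) : ℝ :=
  (1 / (n.choose 2 : ℝ)) *
    ∑ e ∈ Finset.univ.filter (fun e : Sym2 (Fin n) => ¬ e.IsDiag), ∑ i : Bool, ∑ j : Bool,
      if a = setPair y e i ∧ b = setPair z e j then
        bernoulliCoupling (insProb lam zeta y e) (insProb lam zeta z e) i j else 0

theorem bernoulliCoupling_nonneg {p q : ℝ} (hp : 0 ≤ p ∧ p ≤ 1) (hq : 0 ≤ q ∧ q ≤ 1)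
    (i j : Bool) : 0 ≤ bernoulliCoupling p q i j := by
  cases i <;> cases j <;> simp [bernoulliCoupling, hp, hq]

theorem glauberCoupling_nonneg {n : ℕ} {lam zeta : ℝ} (hl : 0 ≤ lam) (hq0 : 0 ≤ 1 - zeta)
    (y z a b : SimpleGraph (Fin n)) : 0 ≤ glauberCoupling lam zeta y z a b := by
  refine mul_nonneg (by positivity) (Finset.sum_nonneg fun e _ => Finset.sum_nonneg fun i _ =>
    Finset.sum_nonneg fun j _ => ?_)
  split_ifs
  · exact bernoulliCoupling_nonneg (insProb_mem_Icc hl hq0 y e) (insProb_mem_Icc hl hq0 z e) i j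
  · rfl

theorem sum_glauberCoupling_right {n : ℕ} {lam zeta : ℝ} (y z a : SimpleGraph (Fin n)) :
    ∑ b, glauberCoupling lam zeta y z a b = glauberStep n lam zeta y a := by
  unfold glauberCoupling glauberStep
  rw [← Finset.mul_sum, Finset.sum_comm]
  congr 1
  refine Finset.sum_congr rfl fun e _ => ?_
  simp only [Fintype.sum_bool, Finset.sum_add_distrib, ite_and, Finset.sum_ite_irrel,
    Finset.sum_ite_eq', Finset.sum_const_zero, Finset.mem_univ, if_true, setPair,
    bernoulliCoupling, Bool.false_eq_true, if_false]
  have := min_add_max (insProb lam zeta y e) (insProb lam zeta z e)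
  split_ifs <;> linarith

theorem sum_glauberCoupling_left {n : ℕ} {lam zeta : ℝ} (y z b : SimpleGraph (Fin n)) :
    ∑ a, glauberCoupling lam zeta y z a b = glauberStep n lam zeta z b := by
  rw [← sum_glauberCoupling_right z y b]
  refine Finset.sum_congr rfl fun a _ => ?_
  unfold glauberCoupling
  congr 1
  refine Finset.sum_congr rfl fun e _ => ?_
  rw [Finset.sum_comm]
  refine Finset.sum_congr rfl fun i _ => Finset.sum_congr rfl fun j _ => ?_
  have : bernoulliCoupling (insProb lam zeta y e) (insProb lam zeta z e) j i =
      bernoulliCoupling (insProb lam zeta z e) (insProb lam zeta y e) i j := by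
    cases i <;> cases j <;> simp [bernoulliCoupling, min_comm, max_comm]
  rw [this]
  simp only [and_comm]

theorem mem_edgeSet_setPair {n : ℕ} (y : SimpleGraph (Fin n)) {e : Sym2 (Fin n)}
    (he : ¬ e.IsDiag) (i : Bool) (f : Sym2 (Fin n)) :
    f ∈ (setPair y e i).edgeSet ↔ (f = e ∧ i = true) ∨ (f ≠ e ∧ f ∈ y.edgeSet) := by
  cases i
  · simp [setPair, and_comm]
  · by_cases hfe : f = e
    · subst hfe
      simp [setPair, he]
    · simp [setPair, hfe]

theorem graphHammingDist_setPair_le {n : ℕ} (y z : SimpleGraph (Fin n)) {e : Sym2 (Fin n)}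
    (he : ¬ e.IsDiag) (i j : Bool) :
    (graphHammingDist (setPair y e i) (setPair z e j) : ℝ) ≤
      graphHammingDist y z - (if e ∈ y.edgeFinset ∆ z.edgeFinset then 1 else 0) +
        (if i = j then 0 else 1) := by
  simp only [graphHammingDist_eq_card_symmDiff]
  set S := y.edgeFinset ∆ z.edgeFinset with hS
  have hcard : ((S.erase e).card : ℝ) = S.card - (if e ∈ S then 1 else 0) := by
    split_ifs with h
    · rw [Finset.cast_card_erase_of_mem h]
    · rw [Finset.erase_eq_of_notMem h, sub_zero]
  rw [← hcard]
  have hmem : ∀ f, f ∈ (setPair y e i).edgeFinset ∆ (setPair z e j).edgeFinset ↔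
      (f = e ∧ i ≠ j) ∨ f ∈ S.erase e := by
    intro f
    rw [Finset.mem_symmDiff, SimpleGraph.mem_edgeFinset, SimpleGraph.mem_edgeFinset,
      mem_edgeSet_setPair y he, mem_edgeSet_setPair z he, Finset.mem_erase, hS,
      Finset.mem_symmDiff, SimpleGraph.mem_edgeFinset, SimpleGraph.mem_edgeFinset]
    by_cases hf : f = e <;> cases i <;> cases j <;> simp [hf]
  split_ifs with hij
  · rw [add_zero, Nat.cast_le]
    exact Finset.card_le_card fun f hf => by simpa [hij] using (hmem f).1 hf
  · norm_cast
    refine (Finset.card_le_card fun f hf => ?_).trans (Finset.card_insert_le e _)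
    rw [Finset.mem_insert]
    exact ((hmem f).1 hf).imp_left And.left

theorem sum_sum_ite_and_mul {α β : Type*} [Fintype α] [Fintype β] (x : α) (x' : β) (w : ℝ)
    (f : α → β → ℝ) :
    ∑ a, ∑ b, (if a = x ∧ b = x' then w else 0) * f a b = w * f x x' := by
  simp [ite_and, ite_mul, Finset.sum_ite_irrel]

theorem sum_glauberCoupling_mul_dist_le {n : ℕ} {lam zeta : ℝ} (hl : 0 ≤ lam)
    (hq0 : 0 ≤ 1 - zeta) (y z : SimpleGraph (Fin n)) (hn : 0 < (n.choose 2 : ℝ)) :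
    ∑ a, ∑ b, glauberCoupling lam zeta y z a b * (graphHammingDist a b : ℝ) ≤
      graphHammingDist y z - graphHammingDist y z / (n.choose 2 : ℝ) +
        (∑ e ∈ Finset.univ.filter (fun e : Sym2 (Fin n) => ¬ e.IsDiag),
          |insProb lam zeta y e - insProb lam zeta z e|) / (n.choose 2 : ℝ) := by
  set E := Finset.univ.filter (fun e : Sym2 (Fin n) => ¬ e.IsDiag) with hE
  set D : ℝ := (graphHammingDist y z : ℝ) with hD
  set S := y.edgeFinset ∆ z.edgeFinset with hS
  set w : Sym2 (Fin n) → Bool → Bool → ℝ := fun e =>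
    bernoulliCoupling (insProb lam zeta y e) (insProb lam zeta z e) with hw
  have hswap : ∑ a, ∑ b, glauberCoupling lam zeta y z a b * (graphHammingDist a b : ℝ) =
      (1 / (n.choose 2 : ℝ)) * ∑ e ∈ E, ∑ i : Bool, ∑ j : Bool,
        w e i j * (graphHammingDist (setPair y e i) (setPair z e j) : ℝ) := by
    unfold glauberCoupling
    simp only [mul_assoc, ← Finset.mul_sum, Finset.sum_mul]
    congr 1
    rw [Finset.sum_congr rfl fun a _ => Finset.sum_comm, Finset.sum_comm]
    refine Finset.sum_congr rfl fun e _ => ?_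
    rw [Finset.sum_congr rfl fun a _ => Finset.sum_comm, Finset.sum_comm]
    refine Finset.sum_congr rfl fun i _ => ?_
    rw [Finset.sum_congr rfl fun a _ => Finset.sum_comm, Finset.sum_comm]
    refine Finset.sum_congr rfl fun j _ => ?_
    exact sum_sum_ite_and_mul _ _ _ fun a b => (graphHammingDist a b : ℝ)
  have hpair : ∀ e ∈ E, ∑ i : Bool, ∑ j : Bool,
      w e i j * (graphHammingDist (setPair y e i) (setPair z e j) : ℝ) ≤
        D - (if e ∈ S then 1 else 0) + |insProb lam zeta y e - insProb lam zeta z e| := by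
    intro e he
    have he' : ¬ e.IsDiag := (Finset.mem_filter.1 he).2
    calc _ ≤ ∑ i : Bool, ∑ j : Bool, w e i j *
          (D - (if e ∈ S then 1 else 0) + (if i = j then 0 else 1)) :=
          Finset.sum_le_sum fun i _ => Finset.sum_le_sum fun j _ =>
            mul_le_mul_of_nonneg_left (graphHammingDist_setPair_le y z he' i j)
              (bernoulliCoupling_nonneg (insProb_mem_Icc hl hq0 y e)
                (insProb_mem_Icc hl hq0 z e) i j)
      _ = _ := by
        simp only [Fintype.sum_bool, hw, bernoulliCoupling, if_true, Bool.true_eq_false,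
          Bool.false_eq_true, if_false]
        rw [← max_sub_min_eq_abs']
        have := min_add_max (insProb lam zeta y e) (insProb lam zeta z e)
        linear_combination (-(D - (if e ∈ S then 1 else 0)) - 1) * this
  have hEcard : (E.card : ℝ) = (n.choose 2 : ℝ) := by
    have := Sym2.card_subtype_not_diag (α := Fin n)
    rw [Fintype.card_subtype, Fintype.card_fin] at this
    rw [← this]
  have hSum : ∑ e ∈ E, (if e ∈ S then (1 : ℝ) else 0) = D := by
    rw [Finset.sum_ite_mem, hD, graphHammingDist_eq_card_symmDiff, Finset.inter_eq_right.2]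
    · simp [hS]
    · intro e he
      rw [hE, Finset.mem_filter]
      refine ⟨Finset.mem_univ _, ?_⟩
      rcases Finset.mem_symmDiff.1 he with h | h
      · exact y.not_isDiag_of_mem_edgeSet (SimpleGraph.mem_edgeFinset.1 h.1)
      · exact z.not_isDiag_of_mem_edgeSet (SimpleGraph.mem_edgeFinset.1 h.1)
  rw [hswap]
  refine (mul_le_mul_of_nonneg_left (Finset.sum_le_sum hpair) (by positivity)).trans_eq ?_
  rw [Finset.sum_add_distrib, Finset.sum_sub_distrib, hSum, Finset.sum_const, nsmul_eq_mul, hEcard]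
  field_simp

/-- **Lemma (contraction of the graph Glauber dynamics `P_{λ,ζ}` on bounded-degree
graphs).** -/
theorem glauber_graph_contraction
    (zeta c : ℝ) (hzeta : zeta ∈ Set.Ioc (0 : ℝ) 1) (hc : 0 < c)
    (hxi : 0 < 1 - 2 * zeta * c ^ 2)
    (lam : ℕ → ℝ) (hlam : ∀ n, 0 < lam n)
    (hlc : Tendsto (fun n : ℕ => Real.sqrt n * lam n) atTop (nhds c)) :
    ∀ᶠ n : ℕ in atTop, ∀ y z : SimpleGraph (Fin n),
      (maxDegN y : ℝ) ≤ lam n * n + Real.sqrt (lam n * n) * Real.log n →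
      (maxDegN z : ℝ) ≤ lam n * n + Real.sqrt (lam n * n) * Real.log n →
      ∃ π : SimpleGraph (Fin n) × SimpleGraph (Fin n) → ℝ,
        (∀ x, 0 ≤ π x) ∧
        (∀ a : SimpleGraph (Fin n),
          ∑ b : SimpleGraph (Fin n), π (a, b) = glauberStep n (lam n) zeta y a) ∧
        (∀ b : SimpleGraph (Fin n),
          ∑ a : SimpleGraph (Fin n), π (a, b) = glauberStep n (lam n) zeta z b) ∧
        (∑ a : SimpleGraph (Fin n), ∑ b : SimpleGraph (Fin n),
            π (a, b) * (graphHammingDist a b : ℝ)) ≤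
          (1 - (1 - 2 * zeta * c ^ 2) / (n : ℝ) ^ 2) * (graphHammingDist y z : ℝ) := by
  have hq0 : 0 ≤ 1 - zeta := by linarith [hzeta.2]
  have hev : ∀ᶠ n : ℕ in atTop, 2 * zeta *
      (lam n * (lam n * n + Real.sqrt (lam n * n) * Real.log n)) < 1 / 2 + zeta * c ^ 2 := by
    have h := (tendsto_mul_degree_bound hlam hlc).const_mul (2 * zeta)
    exact h.eventually_lt_const (by linarith)
  filter_upwards [hev, eventually_ge_atTop 2] with n hn hn2 y z hy hz
  have hl := hlam n
  refine ⟨fun x => glauberCoupling (lam n) zeta y z x.1 x.2, ?_, ?_, ?_, ?_⟩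
  · exact fun x => glauberCoupling_nonneg hl.le hq0 y z x.1 x.2
  · exact fun a => sum_glauberCoupling_right y z a
  · exact fun b => sum_glauberCoupling_left y z b
  · set D : ℝ := (graphHammingDist y z : ℝ) with hD
    set N : ℝ := (n.choose 2 : ℝ) with hN
    set B : ℝ := lam n * n + Real.sqrt (lam n * n) * Real.log n with hB
    have hn2' : (2 : ℝ) ≤ n := by exact_mod_cast hn2
    have hNval : N = n * (n - 1) / 2 := Nat.cast_choose_two ℝ n
    have hNpos : 0 < N := by rw [hNval]; nlinarith
    have hD0 : 0 ≤ D := Nat.cast_nonneg _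
    have hE := sum_glauberCoupling_mul_dist_le hl.le hq0 y z hNpos
    have hS : ∑ e ∈ Finset.univ.filter (fun e : Sym2 (Fin n) => ¬ e.IsDiag),
        |insProb (lam n) zeta y e - insProb (lam n) zeta z e| ≤ (1 / 2 + zeta * c ^ 2) * D := by
      calc _ ≤ ∑ e ∈ Finset.univ.filter (fun e : Sym2 (Fin n) => ¬ e.IsDiag),
            lam n * zeta * |(triAt y e : ℝ) - triAt z e| :=
            Finset.sum_le_sum fun e _ => abs_insProb_sub_le hl.le hq0 hzeta.1.le y z e
        _ = lam n * zeta * ∑ e ∈ Finset.univ.filter (fun e : Sym2 (Fin n) => ¬ e.IsDiag),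
            |(triAt y e : ℝ) - triAt z e| := by rw [Finset.mul_sum]
        _ ≤ lam n * zeta * (2 * B * D) := by
            have := sum_abs_triAt_sub_le y z hy hz
            have := hzeta.1.le
            gcongr
        _ = 2 * zeta * (lam n * B) * D := by ring
        _ ≤ _ := by gcongr
    refine hE.trans ?_
    have h1 : (D - D / N + (1 / 2 + zeta * c ^ 2) * D / N)
        = (1 - (1 - 2 * zeta * c ^ 2) / (2 * N)) * D := by field_simp; ring
    calc _ ≤ D - D / N + (1 / 2 + zeta * c ^ 2) * D / N := by gcongr
      _ = _ := h1
      _ ≤ _ := by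
        have : 2 * N ≤ (n : ℝ) ^ 2 := by rw [hNval]; nlinarith
        gcongr
end
end

section
/- Fix c > 0 and η ∈ (0,1) with c < c̄(η), and let ζ = ζ(c,η). Let p : ℕ → (0,1) be any sequence with √n·p(n) → c, and set λ(n) = p(n)/(1−p(n)). Then n^{-3/2}·log P_{p(n)}( X ≤ η·E X ) − [ −c/2 − (log(1−ζ))·η·c³/6 + n^{-3/2}·log Z(λ(n), ζ) ] → 0 as n → ∞. Moreover, for every fixed ε > 0, if E_n is any sequence of events (sets of labeled graphs on n vertices) with μ_{λ(n),ζ}(E_n) ≤ e^{−ε·n^{3/2}}, then for all sufficiently large n, P_{p(n)}( E_n | X ≤ η·E X ) ≤ e^{−ε·n^{3/2}/2}. -/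
open Filter
open scoped BigOperators symmDiff Classical

noncomputable section

/-- Weight of a configuration `σ` in a lattice gas with activity `lam`, in which every set `T`
of sites contained in `σ` contributes a factor `Φ T`. -/
def gasWeight {V : Type*} (lam : ℝ) (Φ : Finset V → ℝ) (σ : Finset V) : ℝ :=
  lam ^ σ.card * ∏ T ∈ σ.powerset, Φ T

/-- Partition function of the lattice gas on the set of sites `S`. -/
def gasZ {V : Type*} (lam : ℝ) (Φ : Finset V → ℝ) (S : Finset V) : ℝ :=
  ∑ σ ∈ S.powerset, gasWeight lam Φ σ

/-- Contribution to `gasZ lam Φ S` of the configurations containing `T`. -/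
def gasZIn {V : Type*} [DecidableEq V] (lam : ℝ) (Φ : Finset V → ℝ) (S T : Finset V) : ℝ :=
  ∑ σ ∈ S.powerset with T ⊆ σ, gasWeight lam Φ σ

/-- The interaction seen by the other sites when the site `e` is occupied, with only the
interactions `insert e T`, `T ∈ A`, switched on. -/
def couple {V : Type*} [DecidableEq V] (e : V) (A : Set (Finset V)) (Φ : Finset V → ℝ)
    (T : Finset V) : ℝ :=
  Φ T * if T ∈ A then Φ (insert e T) else 1

/-- The odds that the site `e` is occupied. -/
def gasOdds {V : Type*} [DecidableEq V] (lam : ℝ) (Φ : Finset V → ℝ) (S : Finset V) (e : V) : ℝ :=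
  lam * gasZ lam (couple e Set.univ Φ) (S.erase e) / gasZ lam Φ (S.erase e)

section Gas

variable {V : Type*} {lam : ℝ} {Φ Ψ : Finset V → ℝ} {S T σ : Finset V} {e f g : V}

lemma gasWeight_pos (hl : 0 < lam) (hΦ : ∀ T, 0 < Φ T) (σ : Finset V) :
    0 < gasWeight lam Φ σ :=
  mul_pos (pow_pos hl _) (Finset.prod_pos fun T _ => hΦ T)

lemma gasZ_pos (hl : 0 < lam) (hΦ : ∀ T, 0 < Φ T) (S : Finset V) : 0 < gasZ lam Φ S :=
  Finset.sum_pos (fun σ _ => gasWeight_pos hl hΦ σ) ⟨∅, Finset.empty_mem_powerset S⟩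

lemma gasZ_mono (hl : 0 < lam) (hΦ : ∀ T, 0 < Φ T) (h : ∀ T, Φ T ≤ Ψ T) (S : Finset V) :
    gasZ lam Φ S ≤ gasZ lam Ψ S := by
  refine Finset.sum_le_sum fun σ _ => mul_le_mul_of_nonneg_left ?_ (pow_pos hl _).le
  exact Finset.prod_le_prod (fun T _ => (hΦ T).le) fun T _ => h T

lemma gasZ_congr (h : ∀ T ⊆ S, Φ T = Ψ T) : gasZ lam Φ S = gasZ lam Ψ S := by
  refine Finset.sum_congr rfl fun σ hσ => ?_
  unfold gasWeight
  rw [Finset.prod_congr rfl fun T hT => h T ?_]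
  exact (Finset.mem_powerset.1 hT).trans (Finset.mem_powerset.1 hσ)

variable [DecidableEq V]

lemma gasZIn_nonneg (hl : 0 < lam) (hΦ : ∀ T, 0 < Φ T) (S T : Finset V) :
    0 ≤ gasZIn lam Φ S T :=
  Finset.sum_nonneg fun σ _ => (gasWeight_pos hl hΦ σ).le

lemma gasZIn_empty : gasZIn lam Φ S ∅ = gasZ lam Φ S := by
  simp [gasZIn, gasZ]

lemma gasZIn_anti (hl : 0 < lam) (hΦ : ∀ T, 0 < Φ T) {T' : Finset V} (h : T ⊆ T') :
    gasZIn lam Φ S T' ≤ gasZIn lam Φ S T := by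
  refine Finset.sum_le_sum_of_subset_of_nonneg ?_ fun σ _ _ => (gasWeight_pos hl hΦ σ).le
  intro σ
  simp only [Finset.mem_filter]
  exact fun hσ => ⟨hσ.1, h.trans hσ.2⟩

lemma couple_empty (e : V) (Φ : Finset V → ℝ) : couple e ∅ Φ = Φ := by
  ext T
  simp [couple]

lemma couple_pos (hΦ : ∀ T, 0 < Φ T) (e : V) (A : Set (Finset V)) (T : Finset V) :
    0 < couple e A Φ T := by
  unfold couple
  split_ifs
  · exact mul_pos (hΦ _) (hΦ _)
  · simpa using hΦ T

lemma couple_le_one (hΦ : ∀ T, 0 < Φ T) (h1 : ∀ T, Φ T ≤ 1) (e : V) (A : Set (Finset V))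
    (T : Finset V) : couple e A Φ T ≤ 1 := by
  unfold couple
  split_ifs
  · exact mul_le_one₀ (h1 _) (hΦ _).le (h1 _)
  · simpa using h1 T

lemma couple_anti (hΦ : ∀ T, 0 < Φ T) (h1 : ∀ T, Φ T ≤ 1) (e : V) {A B : Set (Finset V)}
    (hAB : A ⊆ B) (T : Finset V) : couple e B Φ T ≤ couple e A Φ T := by
  unfold couple
  refine mul_le_mul_of_nonneg_left ?_ (hΦ T).le
  by_cases hA : T ∈ A
  · simp [hA, hAB hA]
  · rw [if_neg hA]
    split_ifs
    · exact h1 _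
    · exact le_rfl

lemma gasWeight_insert (hf : f ∉ σ) :
    gasWeight lam Φ (insert f σ) = lam * gasWeight lam (couple f Set.univ Φ) σ := by
  unfold gasWeight couple
  rw [Finset.card_insert_of_notMem hf, Finset.prod_powerset_insert hf]
  simp only [Set.mem_univ, if_true, Finset.prod_mul_distrib]
  ring

lemma gasZIn_insert (hf : f ∈ S) (hT : f ∉ T) :
    gasZIn lam Φ S (insert f T) = lam * gasZIn lam (couple f Set.univ Φ) (S.erase f) T := by
  unfold gasZIn
  rw [Finset.mul_sum]
  refine Finset.sum_bij' (fun σ _ => σ.erase f) (fun σ _ => insert f σ) ?_ ?_ ?_ ?_ ?_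
  · intro σ hσ
    simp only [Finset.mem_filter, Finset.mem_powerset, Finset.insert_subset_iff] at hσ ⊢
    exact ⟨Finset.erase_subset_erase _ hσ.1, Finset.subset_erase.2 ⟨hσ.2.2, hT⟩⟩
  · intro σ hσ
    simp only [Finset.mem_filter, Finset.mem_powerset] at hσ ⊢
    exact ⟨Finset.insert_subset hf (hσ.1.trans (Finset.erase_subset _ _)),
      Finset.insert_subset_insert _ hσ.2⟩
  · intro σ hσ
    simp only [Finset.mem_filter, Finset.insert_subset_iff] at hσ
    exact Finset.insert_erase hσ.2.1
  · intro σ hσ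
    simp only [Finset.mem_filter, Finset.mem_powerset] at hσ
    exact Finset.erase_insert fun h => Finset.notMem_erase f S (hσ.1 h)
  · intro σ hσ
    simp only [Finset.mem_filter, Finset.insert_subset_iff] at hσ
    conv_lhs => rw [← Finset.insert_erase hσ.2.1]
    exact gasWeight_insert (Finset.notMem_erase _ _)

lemma gasZIn_singleton (hf : f ∈ S) :
    gasZIn lam Φ S {f} = lam * gasZ lam (couple f Set.univ Φ) (S.erase f) := by
  rw [← gasZIn_empty, ← gasZIn_insert hf (Finset.notMem_empty f), insert_empty_eq]

lemma gasZ_eq_add (hf : f ∈ S) :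
    gasZ lam Φ S = gasZ lam Φ (S.erase f) + lam * gasZ lam (couple f Set.univ Φ) (S.erase f) := by
  conv_lhs => rw [← Finset.insert_erase hf]
  unfold gasZ
  rw [Finset.sum_powerset_insert (Finset.notMem_erase f S), Finset.mul_sum]
  congr 1
  refine Finset.sum_congr rfl fun σ hσ => gasWeight_insert fun h => ?_
  exact Finset.notMem_erase f S (Finset.mem_powerset.1 hσ h)

lemma gasOdds_pos (hl : 0 < lam) (hΦ : ∀ T, 0 < Φ T) : 0 < gasOdds lam Φ S e :=
  div_pos (mul_pos hl (gasZ_pos hl (couple_pos hΦ e _) _)) (gasZ_pos hl hΦ _)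

lemma gasOdds_le (hl : 0 < lam) (hΦ : ∀ T, 0 < Φ T) (h1 : ∀ T, Φ T ≤ 1) :
    gasOdds lam Φ S e ≤ lam := by
  unfold gasOdds
  rw [div_le_iff₀ (gasZ_pos hl hΦ _)]
  refine mul_le_mul_of_nonneg_left (gasZ_mono hl (couple_pos hΦ e _) (fun T => ?_) _) hl.le
  have := couple_anti hΦ h1 e (Set.empty_subset Set.univ) T
  simpa [couple] using this

lemma gasZ_eq_one_add_odds (hl : 0 < lam) (hΦ : ∀ T, 0 < Φ T) (hf : f ∈ S) :
    gasZ lam Φ S = (1 + gasOdds lam Φ S f) * gasZ lam Φ (S.erase f) := by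
  have := (gasZ_pos hl hΦ (S.erase f)).ne'
  rw [gasZ_eq_add hf, gasOdds]
  field_simp

lemma gasZIn_singleton_eq (hl : 0 < lam) (hΦ : ∀ T, 0 < Φ T) (hf : f ∈ S) :
    gasZIn lam Φ S {f} =
      gasOdds lam Φ S f / (1 + gasOdds lam Φ S f) * gasZ lam Φ S := by
  have h0 := (gasZ_pos hl hΦ (S.erase f)).ne'
  have h1 : 1 + gasOdds lam Φ S f ≠ 0 := by linarith [gasOdds_pos (S := S) (e := f) hl hΦ]
  rw [gasZ_eq_one_add_odds hl hΦ hf, gasZIn_singleton hf]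
  rw [div_mul_eq_mul_div, mul_left_comm, mul_div_cancel_left₀ _ h1, gasOdds,
    div_mul_cancel₀ _ h0]

lemma gasZIn_pair_eq (hl : 0 < lam) (hΦ : ∀ T, 0 < Φ T) (hf : f ∈ S) (hg : g ∈ S) (hfg : f ≠ g) :
    gasZIn lam Φ S {f, g} =
      gasOdds lam Φ S f / (1 + gasOdds lam Φ S f) *
        (gasOdds lam (couple f Set.univ Φ) (S.erase f) g /
          (1 + gasOdds lam (couple f Set.univ Φ) (S.erase f) g)) * gasZ lam Φ S := by
  rw [gasZIn_insert hf (by simpa using hfg),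
    gasZIn_singleton_eq hl (couple_pos hΦ f _) (Finset.mem_erase.2 ⟨hfg.symm, hg⟩)]
  have := gasZIn_singleton_eq hl hΦ hf
  rw [gasZIn_singleton hf] at this
  linear_combination (gasOdds lam (couple f Set.univ Φ) (S.erase f) g /
          (1 + gasOdds lam (couple f Set.univ Φ) (S.erase f) g)) * this

lemma gasZIn_le (hl : 0 < lam) (hΦ : ∀ T, 0 < Φ T) (h1 : ∀ T, Φ T ≤ 1) (hTS : T ⊆ S)
    (hT : T.Nonempty) : gasZIn lam Φ S T ≤ lam * gasZ lam Φ S := by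
  obtain ⟨f, hf⟩ := hT
  refine (gasZIn_anti hl hΦ (Finset.singleton_subset_iff.2 hf)).trans ?_
  rw [gasZIn_singleton_eq hl hΦ (hTS hf)]
  refine mul_le_mul_of_nonneg_right ?_ (gasZ_pos hl hΦ S).le
  have h := gasOdds_pos (S := S) (e := f) hl hΦ
  exact (div_le_self h.le (by linarith)).trans (gasOdds_le hl hΦ h1)

lemma gasWeight_couple_insert {A : Set (Finset V)} (hT : T ∉ A) (σ : Finset V) :
    gasWeight lam (couple e (insert T A) Φ) σ =
      gasWeight lam (couple e A Φ) σ * if T ⊆ σ then Φ (insert e T) else 1 := by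
  have hne : ∀ T' ≠ T, couple e (insert T A) Φ T' = couple e A Φ T' := by
    intro T' h
    simp [couple, h]
  unfold gasWeight
  split_ifs with h
  · have hm : T ∈ σ.powerset := Finset.mem_powerset.2 h
    rw [← Finset.mul_prod_erase _ _ hm, ← Finset.mul_prod_erase _ (couple e A Φ) hm,
      Finset.prod_congr rfl fun T' hT' => hne T' (Finset.ne_of_mem_erase hT')]
    have h1 : couple e (insert T A) Φ T = Φ T * Φ (insert e T) := by simp [couple]
    have h2 : couple e A Φ T = Φ T := by simp [couple, hT]
    rw [h1, h2]
    ring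
  · rw [Finset.prod_congr rfl fun T' hT' => hne T' ?_, mul_one]
    rintro rfl
    exact h (Finset.mem_powerset.1 hT')

lemma gasZ_couple_insert {A : Set (Finset V)} (hT : T ∉ A) :
    gasZ lam (couple e (insert T A) Φ) S =
      gasZ lam (couple e A Φ) S -
        (1 - Φ (insert e T)) * gasZIn lam (couple e A Φ) S T := by
  unfold gasZ gasZIn
  rw [Finset.sum_congr rfl fun σ _ => gasWeight_couple_insert hT σ, Finset.sum_filter,
    Finset.mul_sum, ← Finset.sum_sub_distrib]
  refine Finset.sum_congr rfl fun σ _ => ?_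
  split_ifs <;> ring

lemma gasZIn_couple_insert {A : Set (Finset V)} (hT : T ∉ A) :
    gasZIn lam (couple e (insert T A) Φ) S T =
      Φ (insert e T) * gasZIn lam (couple e A Φ) S T := by
  unfold gasZIn
  rw [Finset.mul_sum]
  refine Finset.sum_congr rfl fun σ hσ => ?_
  rw [gasWeight_couple_insert hT, if_pos (Finset.mem_filter.1 hσ).2, mul_comm]

lemma prod_mul_gasZ_le_gasZ_couple (h : Finset V → ℝ) (U : Finset (Finset V))
    (h1 : ∀ T ∈ U, h T ≤ 1)
    (hU : ∀ A : Finset (Finset V), ∀ T ∈ U, T ∉ A →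
      (1 - Φ (insert e T)) * gasZIn lam (couple e A Φ) S T ≤ h T * gasZ lam (couple e A Φ) S) :
    (∏ T ∈ U, (1 - h T)) * gasZ lam Φ S ≤ gasZ lam (couple e U Φ) S := by
  induction U using Finset.induction_on with
  | empty => simp [couple_empty]
  | insert T U hT ih =>
    rw [Finset.coe_insert, gasZ_couple_insert (by exact_mod_cast hT), Finset.prod_insert hT,
      mul_assoc]
    have h2 := ih (fun T hT => h1 T (Finset.mem_insert_of_mem hT))
      (fun A T hT => hU A T (Finset.mem_insert_of_mem hT))
    have h3 := hU U T (Finset.mem_insert_self _ _) hT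
    have h4 := h1 T (Finset.mem_insert_self _ _)
    nlinarith [mul_le_mul_of_nonneg_left h2 (sub_nonneg.2 h4)]

lemma gasZ_couple_le_prod_mul_gasZ (h : Finset V → ℝ) (U : Finset (Finset V))
    (h1 : ∀ T ∈ U, h T ≤ 1)
    (hU : ∀ A : Finset (Finset V), ∀ T ∈ U, T ∉ A →
      h T * gasZ lam (couple e A Φ) S ≤ (1 - Φ (insert e T)) * gasZIn lam (couple e A Φ) S T) :
    gasZ lam (couple e U Φ) S ≤ (∏ T ∈ U, (1 - h T)) * gasZ lam Φ S := by
  induction U using Finset.induction_on with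
  | empty => simp [couple_empty]
  | insert T U hT ih =>
    rw [Finset.coe_insert, gasZ_couple_insert (by exact_mod_cast hT), Finset.prod_insert hT,
      mul_assoc]
    have h2 := ih (fun T hT => h1 T (Finset.mem_insert_of_mem hT))
      (fun A T hT => hU A T (Finset.mem_insert_of_mem hT))
    have h3 := hU U T (Finset.mem_insert_self _ _) hT
    have h4 := h1 T (Finset.mem_insert_self _ _)
    nlinarith [mul_le_mul_of_nonneg_left h2 (sub_nonneg.2 h4)]

end Gas

/-- `H` is a linear 3-uniform hypergraph on the vertex set `S`, regular of degree `d`. -/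
structure IsLinearTriples {V : Type*} [DecidableEq V] (H : Finset (Finset V)) (S : Finset V)
    (d : ℕ) : Prop where
  card_eq : ∀ τ ∈ H, τ.card = 3
  subset : ∀ τ ∈ H, τ ⊆ S
  linear : ∀ τ ∈ H, ∀ τ' ∈ H, ∀ x ∈ τ, ∀ y ∈ τ, x ∈ τ' → y ∈ τ' → x ≠ y → τ = τ'
  degree : ∀ x ∈ S, (H.filter fun τ => x ∈ τ).card = d

/-- The interaction `Φ` arises from the interaction `1 - ζ` on the triples in `H` by switching on
or off some of the interactions with sites in `D`. -/
structure IsPerturbed {V : Type*} [DecidableEq V] (H : Finset (Finset V)) (ζ : ℝ) (D : Finset V)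
    (Φ : Finset V → ℝ) : Prop where
  pos : ∀ T, 0 < Φ T
  le_one : ∀ T, Φ T ≤ 1
  supp : ∀ T, Disjoint T D → T.Nonempty → Φ T ≠ 1 → ∃ τ ∈ H, T ⊆ τ ∧ τ \ T ⊆ D
  exact_eq : ∀ τ ∈ H, Disjoint τ D → Φ τ = 1 - ζ

/-- Uniform bounds on the odds of all sites in all perturbations involving at most `k` sites. -/
def OddsBound {V : Type*} [DecidableEq V] (lam : ℝ) (H : Finset (Finset V)) (S : Finset V)
    (ζ : ℝ) (k : ℕ) (a b : ℝ) : Prop :=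
  ∀ (D : Finset V) (Φ : Finset V → ℝ) (e : V), IsPerturbed H ζ D Φ → D.card ≤ k → e ∈ S \ D →
    Φ {e} = 1 → a ≤ gasOdds lam Φ (S \ D) e ∧ gasOdds lam Φ (S \ D) e ≤ b

/-- Sites in `D` or completed to a triple by two sites in `D`. -/
def blocked {V : Type*} [DecidableEq V] (H : Finset (Finset V)) (D : Finset V) : Finset V :=
  D ∪ (H.biUnion id).filter fun f => f ∉ D ∧ ∃ τ ∈ H, f ∈ τ ∧ τ.erase f ⊆ D

section Triples

variable {V : Type*} [DecidableEq V] {lam ζ : ℝ} {Φ : Finset V → ℝ} {S D τ T : Finset V}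
  {H : Finset (Finset V)} {d k : ℕ} {e f g : V} {a b : ℝ}

lemma card_blocked_le (hH : IsLinearTriples H S d) (hD : D.card ≤ k) :
    (blocked H D).card ≤ k + k * k := by
  refine (Finset.card_union_le _ _).trans (add_le_add hD ?_)
  have key : ∀ f ∈ (H.biUnion id).filter fun f => f ∉ D ∧ ∃ τ ∈ H, f ∈ τ ∧ τ.erase f ⊆ D,
      ∃ q : V × V, q ∈ D ×ˢ D ∧ q.1 ≠ q.2 ∧ f ∉ D ∧ ∃ τ ∈ H, f ∈ τ ∧ τ.erase f = {q.1, q.2} := by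
    intro f hf
    obtain ⟨-, hfD, τ, hτ, hfτ, hsub⟩ := Finset.mem_filter.1 hf
    have h2 : (τ.erase f).card = 2 := by
      rw [Finset.card_erase_of_mem hfτ, hH.card_eq τ hτ]
    obtain ⟨x, y, hxy, he⟩ := Finset.card_eq_two.1 h2
    refine ⟨(x, y), ?_, hxy, hfD, τ, hτ, hfτ, he⟩
    rw [he] at hsub
    exact Finset.mem_product.2 ⟨hsub (by simp), hsub (by simp)⟩
  choose! q hq hne hfD τ hτ hfτ he using key
  refine (Finset.card_le_card_of_injOn q (t := D ×ˢ D) (fun f hf => hq f hf) ?_).trans ?_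
  · intro f hf f' hf' hff
    have h1 := he f hf
    have h2 := he f' hf'
    rw [← hff] at h2
    have hx : ∀ z, z = (q f).1 ∨ z = (q f).2 → z ∈ τ f ∧ z ∈ τ f' := by
      intro z hz
      have hz' : z ∈ ({(q f).1, (q f).2} : Finset V) := by simpa using hz
      exact ⟨Finset.mem_of_mem_erase (h1 ▸ hz'), Finset.mem_of_mem_erase (h2 ▸ hz')⟩
    have hτe : τ f = τ f' := hH.linear _ (hτ f hf) _ (hτ f' hf') _ (hx _ (Or.inl rfl)).1 _
      (hx _ (Or.inr rfl)).1 (hx _ (Or.inl rfl)).2 (hx _ (Or.inr rfl)).2 (hne f hf)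
    by_contra hcon
    have h3 : f' ∈ (τ f).erase f := Finset.mem_erase.2 ⟨fun h => hcon h.symm, hτe ▸ hfτ f' hf'⟩
    rw [h1, ← h2] at h3
    exact Finset.notMem_erase _ _ h3
  · rw [Finset.card_product]
    exact Nat.mul_le_mul hD hD

lemma card_meet_le (hH : IsLinearTriples H S d) (e : V) (B : Finset V) :
    (H.filter fun τ => e ∈ τ ∧ ¬ Disjoint (τ.erase e) B).card ≤ B.card := by
  have key : ∀ τ ∈ H.filter fun τ => e ∈ τ ∧ ¬ Disjoint (τ.erase e) B,
      ∃ f, f ∈ B ∧ f ∈ τ ∧ f ≠ e ∧ e ∈ τ ∧ τ ∈ H := by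
    intro τ hτ
    obtain ⟨hτH, heτ, hd⟩ := Finset.mem_filter.1 hτ
    obtain ⟨f, hf, hfB⟩ := Finset.not_disjoint_iff.1 hd
    exact ⟨f, hfB, Finset.mem_of_mem_erase hf, Finset.ne_of_mem_erase hf, heτ, hτH⟩
  have : Nonempty V := ⟨e⟩
  choose! f hfB hfτ hne heτ hτH using key
  refine Finset.card_le_card_of_injOn f (fun τ hτ => hfB τ hτ) ?_
  intro τ hτ τ' hτ' h
  exact hH.linear _ (hτH τ hτ) _ (hτH τ' hτ') _ (hfτ τ hτ) _ (heτ τ hτ) (h ▸ hfτ τ' hτ')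
    (heτ τ' hτ') (hne τ hτ)

lemma IsPerturbed.couple (hH : IsLinearTriples H S d) (h : IsPerturbed H ζ D Φ) (e : V)
    (A : Set (Finset V)) (heD : e ∉ D) : IsPerturbed H ζ (insert e D) (couple e A Φ) where
  pos := couple_pos h.pos e A
  le_one := couple_le_one h.pos h.le_one e A
  supp := by
    intro T hT hTn hne
    obtain ⟨heT, hTD⟩ := Finset.disjoint_insert_right.1 hT
    by_cases h1 : Φ T = 1
    · have h2 : Φ (insert e T) ≠ 1 := by
        intro h2
        exact hne (by simp [_root_.couple, h1, h2])
      obtain ⟨τ, hτ, hsub, hD⟩ := h.supp _ (Finset.disjoint_insert_left.2 ⟨heD, hTD⟩)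
        (Finset.insert_nonempty _ _) h2
      refine ⟨τ, hτ, (Finset.subset_insert _ _).trans hsub, ?_⟩
      intro x hx
      by_cases hxe : x = e
      · simp [hxe]
      · refine Finset.mem_insert_of_mem (hD ?_)
        simp only [Finset.mem_sdiff, Finset.mem_insert] at hx ⊢
        tauto
    · obtain ⟨τ, hτ, hsub, hD⟩ := h.supp T hTD hTn h1
      exact ⟨τ, hτ, hsub, hD.trans (Finset.subset_insert _ _)⟩
  exact_eq := by
    intro τ hτ hd
    obtain ⟨heτ, hτD⟩ := Finset.disjoint_insert_right.1 hd
    have h2 : Φ (insert e τ) = 1 := by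
      by_contra h2
      obtain ⟨τ', hτ', hsub, -⟩ := h.supp _ (Finset.disjoint_insert_left.2 ⟨heD, hτD⟩)
        (Finset.insert_nonempty _ _) h2
      have := Finset.card_le_card hsub
      rw [Finset.card_insert_of_notMem heτ, hH.card_eq τ hτ, hH.card_eq τ' hτ'] at this
      omega
    simp [_root_.couple, h2, h.exact_eq τ hτ hτD]

lemma gasZIn_pair_bounds (hH : IsLinearTriples H S d) (hl : 0 < lam)
    (hB : OddsBound lam H S ζ (k + 2) a b) (ha : 0 ≤ a)
    (h : IsPerturbed H ζ D Φ) (hk : D.card ≤ k) (he : e ∈ S \ D)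
    (hτ : τ ∈ H) (heτ : e ∈ τ) (hbl : Disjoint (τ.erase e) (blocked H D))
    (A : Set (Finset V)) (hA : τ.erase e ∉ A) :
    (a / (1 + lam)) ^ 2 * gasZ lam (couple e A Φ) ((S \ D).erase e) ≤
        gasZIn lam (couple e A Φ) ((S \ D).erase e) (τ.erase e) ∧
      gasZIn lam (couple e A Φ) ((S \ D).erase e) (τ.erase e) ≤
        b ^ 2 * gasZ lam (couple e A Φ) ((S \ D).erase e) := by
  have h2 : (τ.erase e).card = 2 := by
    rw [Finset.card_erase_of_mem heτ, hH.card_eq τ hτ]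
  obtain ⟨f, g, hfg, hfge⟩ := Finset.card_eq_two.1 h2
  have heD : e ∉ D := (Finset.mem_sdiff.1 he).2
  have hτe : τ = {e, f, g} := by rw [← Finset.insert_erase heτ, hfge]
  have hf : f ∈ τ.erase e := by simp [hfge]
  have hg : g ∈ τ.erase e := by simp [hfge]
  have hfτ := Finset.mem_of_mem_erase hf
  have hgτ := Finset.mem_of_mem_erase hg
  have hfe := Finset.ne_of_mem_erase hf
  have hge := Finset.ne_of_mem_erase hg
  have hfb := Finset.disjoint_left.1 hbl hf
  have hgb := Finset.disjoint_left.1 hbl hg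
  have hfD : f ∉ D := fun hh => hfb (Finset.mem_union_left _ hh)
  have hgD : g ∉ D := fun hh => hgb (Finset.mem_union_left _ hh)
  have free : ∀ x ∈ τ, x ∉ blocked H D → Φ {x} = 1 := by
    intro x hxτ hxb
    have hxD : x ∉ D := fun hh => hxb (Finset.mem_union_left _ hh)
    by_contra hne
    obtain ⟨τ', hτ', hsub, hD⟩ := h.supp {x} (Finset.disjoint_singleton_left.2 hxD)
      (Finset.singleton_nonempty x) hne
    refine hxb (Finset.mem_union_right _ (Finset.mem_filter.2 ⟨?_, hxD, τ', hτ', ?_, ?_⟩))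
    · exact Finset.mem_biUnion.2 ⟨τ, hτ, hxτ⟩
    · simpa using hsub
    · rwa [Finset.erase_eq]
  have two : ∀ x ∈ τ, ∀ y ∈ τ, ∀ z ∈ τ, x ≠ y → z ≠ x → z ≠ y → x ∉ D → y ∉ D → z ∉ D →
      Φ {x, y} = 1 := by
    intro x hx y hy z hz hxy hzx hzy hxD hyD hzD
    by_contra hne
    obtain ⟨τ', hτ', hsub, hD⟩ := h.supp {x, y} (by simp [hxD, hyD]) (by simp) hne
    have hτ'' : τ = τ' := hH.linear _ hτ _ hτ' _ hx _ hy (hsub (by simp)) (hsub (by simp)) hxy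
    exact hzD (hD (Finset.mem_sdiff.2 ⟨hτ'' ▸ hz, by simp [hzx, hzy]⟩))
  set Ψ := _root_.couple e A Φ with hΨ
  have hp1 : IsPerturbed H ζ (insert e D) Ψ := h.couple hH e A heD
  have hf' : f ∉ insert e D := by simp [hfe, hfD]
  have hp2 : IsPerturbed H ζ (insert f (insert e D)) (_root_.couple f Set.univ Ψ) :=
    hp1.couple hH f _ hf'
  have hΨf : Ψ {f} = 1 := by
    have h3 := two e heτ f hfτ g hgτ hfe.symm hge hfg.symm heD hfD hgD
    simp [hΨ, _root_.couple, free f hfτ hfb, h3]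
  have hΨg : _root_.couple f Set.univ Ψ {g} = 1 := by
    have h3 := two e heτ g hgτ f hfτ hge.symm hfe hfg heD hgD hfD
    have h4 := two f hfτ g hgτ e heτ hfg hfe.symm hge.symm hfD hgD heD
    rw [hfge] at hA
    simp [hΨ, _root_.couple, free g hgτ hgb, h3, h4, hA]
  have hc1 : (insert e D).card ≤ k + 1 := (Finset.card_insert_le _ _).trans (by omega)
  have hc2 : (insert f (insert e D)).card ≤ k + 2 := (Finset.card_insert_le _ _).trans (by omega)
  have hfS : f ∈ S \ insert e D := Finset.mem_sdiff.2 ⟨hH.subset τ hτ hfτ, hf'⟩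
  have hgS : g ∈ S \ insert f (insert e D) :=
    Finset.mem_sdiff.2 ⟨hH.subset τ hτ hgτ, by simp [hge, hgD, hfg.symm]⟩
  obtain ⟨l1, u1⟩ := hB _ _ f hp1 (hc1.trans (by omega)) hfS hΨf
  obtain ⟨l2, u2⟩ := hB _ _ g hp2 hc2 hgS hΨg
  have e1 : S \ insert e D = (S \ D).erase e := Finset.sdiff_insert ..
  have e2 : S \ insert f (insert e D) = ((S \ D).erase e).erase f := by
    rw [Finset.sdiff_insert, e1]
  have m1 := gasOdds_le (S := S \ insert e D) (e := f) hl hp1.pos hp1.le_one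
  have m2 := gasOdds_le (S := S \ insert f (insert e D)) (e := g) hl hp2.pos hp2.le_one
  rw [e1] at l1 u1 m1 hfS
  rw [e2] at l2 u2 m2 hgS
  rw [hfge, gasZIn_pair_eq hl hp1.pos hfS (Finset.mem_of_mem_erase hgS) hfg]
  have hZ := (gasZ_pos hl hp1.pos ((S \ D).erase e)).le
  have lo : ∀ r, a ≤ r → r ≤ lam → a / (1 + lam) ≤ r / (1 + r) := by
    intro r h1 h2
    exact div_le_div₀ (ha.trans h1) h1 (by linarith) (by linarith)
  have up : ∀ r, a ≤ r → r ≤ b → r / (1 + r) ≤ b := by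
    intro r h1 h2
    exact (div_le_self (ha.trans h1) (by linarith)).trans h2
  have nn : ∀ r, a ≤ r → 0 ≤ r / (1 + r) := fun r h1 =>
    div_nonneg (ha.trans h1) (by linarith)
  constructor
  · refine mul_le_mul_of_nonneg_right ?_ hZ
    rw [sq]
    exact mul_le_mul (lo _ l1 m1) (lo _ l2 m2) (div_nonneg ha (by linarith)) (nn _ l1)
  · refine mul_le_mul_of_nonneg_right ?_ hZ
    rw [sq]
    exact mul_le_mul (up _ l1 u1) (up _ l2 u2) (nn _ l2) ((ha.trans l1).trans u1)

end Triples

section Recursion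

variable {V : Type*} [DecidableEq V] {lam ζ : ℝ} {Φ : Finset V → ℝ} {S D τ T : Finset V}
  {H : Finset (Finset V)} {d k : ℕ} {e f g : V} {a b : ℝ}

lemma OddsBound.step (hH : IsLinearTriples H S d) (hl : 0 < lam) (hl1 : lam ≤ 1)
    (hζ : 0 ≤ ζ) (hζ1 : ζ < 1) (ha : 0 ≤ a) (hb1 : b ≤ 1)
    (hB : OddsBound lam H S ζ (k + 2) a b) :
    OddsBound lam H S ζ k
      (lam * ((1 - ζ * b ^ 2) ^ d * (1 - lam) ^ (4 * (k + k * k))))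
      (lam * (1 - ζ * (a / (1 + lam)) ^ 2) ^ (d - (k + k * k))) := by
  intro D Φ e h hk he he1
  obtain ⟨heS, heD⟩ := Finset.mem_sdiff.1 he
  set K := k + k * k with hK
  set S' := (S \ D).erase e with hS'
  have hbK : (blocked H D).card ≤ K := card_blocked_le hH hk
  set good := H.filter fun τ => e ∈ τ ∧ Disjoint (τ.erase e) (blocked H D) with hgood
  set bad := H.filter fun τ => e ∈ τ ∧ ¬ Disjoint (τ.erase e) (blocked H D) with hbad
  have hbadK : bad.card ≤ K := (card_meet_le hH e _).trans hbK
  have hsum : good.card + bad.card = d := by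
    rw [← hH.degree e heS, ← Finset.card_filter_add_card_filter_not
      (s := H.filter fun τ => e ∈ τ) (fun τ => Disjoint (τ.erase e) (blocked H D)),
      Finset.filter_filter, Finset.filter_filter]
  set U₁ := good.image fun τ => τ.erase e with hU₁
  set U₂ := ((bad.biUnion fun τ => (τ.erase e).powerset).filter
    fun T => T.Nonempty ∧ T ⊆ S') \ U₁ with hU₂
  have hU₁card : U₁.card = good.card := by
    refine Finset.card_image_of_injOn fun τ hτ τ' hτ' hh => ?_
    rw [← Finset.insert_erase (Finset.mem_filter.1 hτ).2.1,
      ← Finset.insert_erase (Finset.mem_filter.1 hτ').2.1]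
    exact congrArg _ hh
  have hU₂card : U₂.card ≤ 4 * K := by
    refine (Finset.card_le_card (Finset.sdiff_subset.trans (Finset.filter_subset _ _))).trans ?_
    refine (Finset.card_biUnion_le_card_mul _ _ 4 ?_).trans (by omega)
    intro τ hτ
    obtain ⟨hτH, heτ, -⟩ := Finset.mem_filter.1 hτ
    rw [Finset.card_powerset, Finset.card_erase_of_mem heτ, hH.card_eq τ hτH]
    norm_num
  have hP : ∀ A : Finset (Finset V), IsPerturbed H ζ (insert e D) (couple e A Φ) :=
    fun A => h.couple hH e A heD
  have hgΦ : ∀ τ ∈ good, Φ (insert e (τ.erase e)) = 1 - ζ := by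
    intro τ hτ
    obtain ⟨hτH, heτ, hd⟩ := Finset.mem_filter.1 hτ
    rw [Finset.insert_erase heτ]
    refine h.exact_eq τ hτH ?_
    rw [← Finset.insert_erase heτ, Finset.disjoint_insert_left]
    exact ⟨heD, hd.mono_right Finset.subset_union_left⟩
  have hgood_bounds : ∀ A : Finset (Finset V), ∀ T ∈ U₁, T ∉ A →
      ζ * (a / (1 + lam)) ^ 2 * gasZ lam (couple e A Φ) S' ≤
        (1 - Φ (insert e T)) * gasZIn lam (couple e A Φ) S' T ∧
      (1 - Φ (insert e T)) * gasZIn lam (couple e A Φ) S' T ≤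
        ζ * b ^ 2 * gasZ lam (couple e A Φ) S' := by
    intro A T hT hTA
    obtain ⟨τ, hτ, rfl⟩ := Finset.mem_image.1 hT
    obtain ⟨hτH, heτ, hd⟩ := Finset.mem_filter.1 hτ
    obtain ⟨h1, h2⟩ := gasZIn_pair_bounds hH hl hB ha h hk he hτH heτ hd A (by exact_mod_cast hTA)
    rw [hgΦ τ hτ, sub_sub_cancel, mul_assoc, mul_assoc]
    exact ⟨mul_le_mul_of_nonneg_left h1 hζ, mul_le_mul_of_nonneg_left h2 hζ⟩
  have hZ := gasZ_pos hl h.pos S'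
  have hU₁U₂ : Disjoint U₁ U₂ := Finset.disjoint_sdiff
  rcases lt_or_ge b a with hab | hab
  · have hO := hB D Φ e h (hk.trans (by omega)) he he1
    linarith [hO.1, hO.2]
  have hb : 0 ≤ b := ha.trans hab
  have hbsq : b ^ 2 ≤ 1 := pow_le_one₀ hb hb1
  have hx1 : ζ * b ^ 2 ≤ 1 := mul_le_one₀ hζ1.le (sq_nonneg b) hbsq
  have hal : 0 ≤ a / (1 + lam) := div_nonneg ha (by linarith)
  have hy1 : ζ * (a / (1 + lam)) ^ 2 ≤ 1 := by
    refine mul_le_one₀ hζ1.le (sq_nonneg _) (pow_le_one₀ hal ?_)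
    exact (div_le_self ha (by linarith)).trans (hab.trans hb1)
  constructor
  · have hcongr : gasZ lam (couple e Set.univ Φ) S' =
        gasZ lam (couple e (U₁ ∪ U₂ : Finset (Finset V)) Φ) S' := by
      refine gasZ_congr fun T hT => ?_
      by_cases hTU : T ∈ U₁ ∪ U₂
      · simp only [couple, Set.mem_univ, if_true, Finset.mem_coe, hTU]
      · simp only [couple, Set.mem_univ, if_true, Finset.mem_coe, hTU, if_false]
        congr 1
        rcases T.eq_empty_or_nonempty with rfl | hTn
        · simpa using he1
        by_contra hne
        have hTD : Disjoint T D := by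
          refine Finset.disjoint_left.2 fun x hx => ?_
          exact (Finset.mem_sdiff.1 (Finset.mem_of_mem_erase (hT hx))).2
        have heT : e ∉ T := fun hh => Finset.notMem_erase _ _ (hT hh)
        obtain ⟨τ, hτ, hsub, hD⟩ := h.supp _ (Finset.disjoint_insert_left.2 ⟨heD, hTD⟩)
          (Finset.insert_nonempty _ _) hne
        have heτ := hsub (Finset.mem_insert_self _ _)
        have hTτ : T ⊆ τ.erase e :=
          Finset.subset_erase.2 ⟨(Finset.subset_insert _ _).trans hsub, heT⟩
        refine hTU ?_
        by_cases hd : Disjoint (τ.erase e) (blocked H D)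
        · refine Finset.mem_union_left _ (Finset.mem_image.2
            ⟨τ, Finset.mem_filter.2 ⟨hτ, heτ, hd⟩, (hTτ.antisymm ?_).symm⟩)
          intro x hx
          by_contra hxT
          refine Finset.disjoint_left.1 hd hx (Finset.mem_union_left _ (hD ?_))
          rw [Finset.mem_erase] at hx
          simp [hx.1, hx.2, hxT]
        · by_cases hT1 : T ∈ U₁
          · exact Finset.mem_union_left _ hT1
          · refine Finset.mem_union_right _ (Finset.mem_sdiff.2 ⟨Finset.mem_filter.2
              ⟨Finset.mem_biUnion.2 ⟨τ, Finset.mem_filter.2 ⟨hτ, heτ, hd⟩,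
                Finset.mem_powerset.2 hTτ⟩, hTn, hT⟩, hT1⟩)
    have hlow := prod_mul_gasZ_le_gasZ_couple (lam := lam) (Φ := Φ) (S := S') (e := e)
      (fun T => if T ∈ U₁ then ζ * b ^ 2 else lam) (U₁ ∪ U₂)
      (by intro T _; split_ifs <;> assumption)
      (by
        intro A T hT hTA
        split_ifs with hT1
        · exact (hgood_bounds A T hT1 hTA).2
        · have hT2 := (Finset.mem_union.1 hT).resolve_left hT1
          obtain ⟨-, hTn, hTS⟩ := Finset.mem_filter.1 (Finset.mem_sdiff.1 hT2).1
          have h3 := gasZIn_le hl (hP A).pos (hP A).le_one hTS hTn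
          have h4 := gasZIn_nonneg hl (hP A).pos S' T
          nlinarith [h.pos (insert e T)])
    rw [Finset.prod_union hU₁U₂, Finset.prod_congr rfl (g := fun _ => 1 - ζ * b ^ 2)
      (fun T hT => by rw [if_pos hT]), Finset.prod_congr (s₁ := U₂) rfl (g := fun _ => 1 - lam)
      (fun T hT => by rw [if_neg (Finset.mem_sdiff.1 hT).2]), Finset.prod_const,
      Finset.prod_const, ← hcongr] at hlow
    unfold gasOdds
    rw [mul_div_assoc]
    refine mul_le_mul_of_nonneg_left ?_ hl.le
    rw [le_div_iff₀ hZ]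
    refine le_trans (mul_le_mul_of_nonneg_right ?_ hZ.le) hlow
    refine mul_le_mul ?_ ?_ (pow_nonneg (by linarith) _) (pow_nonneg (by linarith) _)
    · exact pow_le_pow_of_le_one (by linarith) (by nlinarith) (by omega)
    · exact pow_le_pow_of_le_one (by linarith) (by linarith) hU₂card
  · have hup := gasZ_couple_le_prod_mul_gasZ (lam := lam) (Φ := Φ) (S := S') (e := e)
      (fun _ => ζ * (a / (1 + lam)) ^ 2) U₁ (fun _ _ => hy1)
      (fun A T hT hTA => (hgood_bounds A T hT hTA).1)
    rw [Finset.prod_const] at hup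
    unfold gasOdds
    rw [mul_div_assoc]
    refine mul_le_mul_of_nonneg_left ?_ hl.le
    rw [div_le_iff₀ hZ]
    refine (gasZ_mono hl (couple_pos h.pos e _)
      (couple_anti h.pos h.le_one e (Set.subset_univ (U₁ : Set (Finset V)))) S').trans
      (hup.trans (mul_le_mul_of_nonneg_right ?_ hZ.le))
    refine pow_le_pow_of_le_one (by linarith) ?_ (by omega)
    nlinarith [mul_nonneg hζ (sq_nonneg (a / (1 + lam)))]

lemma oddsBound_trivial (hl : 0 < lam) : OddsBound lam H S ζ k 0 lam :=
  fun _ _ _ h _ _ _ => ⟨(gasOdds_pos hl h.pos).le, gasOdds_le hl h.pos h.le_one⟩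

lemma OddsBound.mono {a' b' : ℝ} (h : OddsBound lam H S ζ k a b) (ha : a' ≤ a) (hb : b ≤ b') :
    OddsBound lam H S ζ k a' b' := fun D Φ e h1 h2 h3 h4 =>
  ⟨ha.trans (h D Φ e h1 h2 h3 h4).1, (h D Φ e h1 h2 h3 h4).2.trans hb⟩

end Recursion

lemma abs_mul_exp_neg_sq_sub_le {c ζ : ℝ} (hc : 0 ≤ c) (hζ : 0 ≤ ζ) (x y : ℝ) :
    |c * Real.exp (-ζ * y ^ 2) - c * Real.exp (-ζ * x ^ 2)| ≤ c * √ζ * |y - x| := by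
  have hd : ∀ z : ℝ, HasDerivAt (fun z => c * Real.exp (-ζ * z ^ 2))
      (c * (Real.exp (-ζ * z ^ 2) * (-ζ * (2 * z)))) z := by
    intro z
    have h1 : HasDerivAt (fun z : ℝ => -ζ * z ^ 2) (-ζ * (2 * z)) z := by
      simpa using (hasDerivAt_pow 2 z).const_mul (-ζ)
    exact h1.exp.const_mul c
  refine Convex.norm_image_sub_le_of_norm_hasDerivWithin_le (s := Set.univ)
    (fun z _ => (hd z).hasDerivWithinAt) (fun z _ => ?_) convex_univ (Set.mem_univ x)
    (Set.mem_univ y)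
  have hs : √ζ * √ζ = ζ := Real.mul_self_sqrt hζ
  have h1 : 1 + ζ * z ^ 2 ≤ Real.exp (ζ * z ^ 2) := by
    linarith [Real.add_one_le_exp (ζ * z ^ 2)]
  have h2 : 2 * (√ζ * |z|) ≤ 1 + ζ * z ^ 2 := by
    have : ζ * z ^ 2 = (√ζ * |z|) ^ 2 := by rw [mul_pow, sq_abs, Real.sq_sqrt hζ]
    nlinarith [sq_nonneg (√ζ * |z| - 1)]
  have h3 : Real.exp (-ζ * z ^ 2) * Real.exp (ζ * z ^ 2) = 1 := by
    rw [← Real.exp_add]; simp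
  rw [Real.norm_eq_abs, abs_mul, abs_mul, abs_mul, abs_mul, abs_neg, abs_of_nonneg hc,
    abs_of_nonneg hζ, Real.abs_exp, abs_two]
  refine mul_le_mul_of_nonneg_left ?_ hc
  have h4 : ζ * (2 * |z|) ≤ √ζ * Real.exp (ζ * z ^ 2) := by
    calc ζ * (2 * |z|) = √ζ * (2 * (√ζ * |z|)) := by linear_combination -(2 * |z|) * hs
      _ ≤ √ζ * Real.exp (ζ * z ^ 2) :=
        mul_le_mul_of_nonneg_left (h2.trans h1) (Real.sqrt_nonneg _)
  calc Real.exp (-ζ * z ^ 2) * (ζ * (2 * |z|))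
      ≤ Real.exp (-ζ * z ^ 2) * (√ζ * Real.exp (ζ * z ^ 2)) :=
        mul_le_mul_of_nonneg_left h4 (Real.exp_pos _).le
    _ = √ζ := by linear_combination √ζ * h3

section Limits

variable {d : ℕ → ℕ} {lam : ℕ → ℝ} {c ζ : ℝ}

lemma tendsto_zero_of_sqrt_mul (hd : Tendsto d atTop atTop)
    (hlc : Tendsto (fun n => √(d n : ℝ) * lam n) atTop (nhds c)) :
    Tendsto lam atTop (nhds 0) := by
  have hs : Tendsto (fun n => √(d n : ℝ)) atTop atTop :=
    Real.tendsto_sqrt_atTop.comp (tendsto_natCast_atTop_atTop.comp hd)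
  refine (hlc.div_atTop hs).congr' ?_
  filter_upwards [hs.eventually_gt_atTop 0] with n hn
  field_simp

lemma tendsto_lower_recursion (hd : Tendsto d atTop atTop)
    (hlc : Tendsto (fun n => √(d n : ℝ) * lam n) atTop (nhds c)) (y : ℝ) (m : ℕ) :
    Tendsto (fun n => √(d n : ℝ) *
      (lam n * ((1 - ζ * (y / √(d n : ℝ)) ^ 2) ^ d n * (1 - lam n) ^ m))) atTop
      (nhds (c * Real.exp (-ζ * y ^ 2))) := by
  have h0 := tendsto_zero_of_sqrt_mul hd hlc
  have h1 : Tendsto (fun n => (1 - lam n) ^ m) atTop (nhds 1) := by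
    simpa using (h0.const_sub 1).pow m
  have h2 : Tendsto (fun n => (1 - ζ * (y / √(d n : ℝ)) ^ 2) ^ d n) atTop
      (nhds (Real.exp (-ζ * y ^ 2))) := by
    refine ((Real.tendsto_one_add_div_pow_exp (-ζ * y ^ 2)).comp hd).congr fun n => ?_
    simp only [Function.comp, div_pow, Real.sq_sqrt (Nat.cast_nonneg (d n))]
    congr 1
    ring
  have h3 := hlc.mul (h2.mul h1)
  rw [mul_one] at h3
  exact h3.congr fun n => by ring

lemma tendsto_upper_recursion (hd : Tendsto d atTop atTop)
    (hlc : Tendsto (fun n => √(d n : ℝ) * lam n) atTop (nhds c)) (y : ℝ) (K : ℕ) :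
    Tendsto (fun n => √(d n : ℝ) * lam n *
      Real.exp (-(ζ * (y / √(d n : ℝ) / (1 + lam n)) ^ 2) * (d n - K : ℕ))) atTop
      (nhds (c * Real.exp (-ζ * y ^ 2))) := by
  have h0 := tendsto_zero_of_sqrt_mul hd hlc
  have hdR : Tendsto (fun n => (d n : ℝ)) atTop atTop := tendsto_natCast_atTop_atTop.comp hd
  refine hlc.mul ((Real.continuous_exp.tendsto _).comp ?_)
  have h1 : Tendsto (fun n => 1 - (K : ℝ) / d n) atTop (nhds 1) := by
    simpa using (hdR.const_div_atTop (K : ℝ)).const_sub 1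
  have h2 : Tendsto (fun n => ((1 + lam n) ^ 2)⁻¹) atTop (nhds 1) := by
    simpa using ((h0.const_add 1).pow 2).inv₀ (by norm_num)
  have h3 := (h2.mul h1).const_mul (-ζ * y ^ 2)
  rw [mul_one, mul_one] at h3
  refine h3.congr' ?_
  filter_upwards [hd.eventually_ge_atTop K, hdR.eventually_gt_atTop 0] with n hn hn0
  rw [Nat.cast_sub hn, div_pow, div_pow, Real.sq_sqrt hn0.le]
  field_simp

variable {V : ℕ → Type*} [∀ n, DecidableEq (V n)] {H : (n : ℕ) → Finset (Finset (V n))}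
  {S : (n : ℕ) → Finset (V n)} {x : ℝ}

lemma eventually_oddsBound_step (hH : ∀ n, IsLinearTriples (H n) (S n) (d n))
    (hl : ∀ n, 0 < lam n) (hd : Tendsto d atTop atTop)
    (hlc : Tendsto (fun n => √(d n : ℝ) * lam n) atTop (nhds c)) (hc : 0 < c)
    (hζ : 0 ≤ ζ) (hζ1 : ζ < 1) (hx : x = c * Real.exp (-ζ * x ^ 2))
    {δ δ' : ℝ} (hδ : 0 ≤ δ) (hδ' : c * √ζ * δ < δ')
    (h : ∀ k, ∀ᶠ n in atTop, OddsBound (lam n) (H n) (S n) ζ k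
      (max (x - δ) 0 / √(d n : ℝ)) ((x + δ) / √(d n : ℝ))) (k : ℕ) :
    ∀ᶠ n in atTop, OddsBound (lam n) (H n) (S n) ζ k
      (max (x - δ') 0 / √(d n : ℝ)) ((x + δ') / √(d n : ℝ)) := by
  have hx0 : 0 < x := hx ▸ mul_pos hc (Real.exp_pos _)
  have h0 := tendsto_zero_of_sqrt_mul hd hlc
  have hs : Tendsto (fun n => √(d n : ℝ)) atTop atTop :=
    Real.tendsto_sqrt_atTop.comp (tendsto_natCast_atTop_atTop.comp hd)
  have hlow : x - δ' < c * Real.exp (-ζ * (x + δ) ^ 2) := by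
    have := abs_mul_exp_neg_sq_sub_le hc.le hζ x (x + δ)
    rw [← hx, add_sub_cancel_left, abs_of_nonneg hδ] at this
    linarith [(abs_le.1 this).1]
  have hup : c * Real.exp (-ζ * (max (x - δ) 0) ^ 2) < x + δ' := by
    have := abs_mul_exp_neg_sq_sub_le hc.le hζ x (max (x - δ) 0)
    have h2 : |max (x - δ) 0 - x| ≤ δ := by
      rw [abs_le]
      constructor
      · linarith [le_max_left (x - δ) 0]
      · rcases max_cases (x - δ) 0 with h | h <;> linarith [h.1]
    have h3 := mul_le_mul_of_nonneg_left h2 (mul_nonneg hc.le (Real.sqrt_nonneg ζ))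
    rw [← hx] at this
    linarith [(abs_le.1 this).2]
  filter_upwards [h (k + 2), hs.eventually_ge_atTop (x + δ), hs.eventually_gt_atTop 0,
    h0.eventually (ge_mem_nhds one_pos),
    (tendsto_lower_recursion (ζ := ζ) hd hlc (x + δ) (4 * (k + k * k))).eventually
      (lt_mem_nhds hlow),
    (tendsto_upper_recursion (ζ := ζ) hd hlc (max (x - δ) 0) (k + k * k)).eventually
      (gt_mem_nhds hup)] with n hn hn1 hn0 hl1 hlo hhi
  have hb1 : (x + δ) / √(d n : ℝ) ≤ 1 := (div_le_one hn0).2 hn1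
  have ha : 0 ≤ max (x - δ) 0 / √(d n : ℝ) := div_nonneg (le_max_right _ _) hn0.le
  have hstep := hn.step (hH n) (hl n) hl1 hζ hζ1 ha hb1
  have hln := hl n
  refine hstep.mono ?_ ?_
  · rw [div_le_iff₀ hn0, mul_comm]
    refine max_le hlo.le (mul_nonneg hn0.le (mul_nonneg (hl n).le (mul_nonneg ?_ ?_)))
    · refine pow_nonneg (sub_nonneg.2 (mul_le_one₀ hζ1.le (sq_nonneg _) ?_)) _
      exact pow_le_one₀ (div_nonneg (by linarith) hn0.le) hb1
    · exact pow_nonneg (by linarith) _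
  · rw [le_div_iff₀ hn0, mul_comm]
    refine le_trans ?_ hhi.le
    rw [← mul_assoc]
    refine mul_le_mul_of_nonneg_left ?_ (mul_nonneg hn0.le (hl n).le)
    rw [mul_comm _ ((d n - (k + k * k) : ℕ) : ℝ), Real.exp_nat_mul]
    refine pow_le_pow_left₀ (sub_nonneg.2 (mul_le_one₀ hζ1.le (sq_nonneg _) ?_)) ?_ _
    · refine pow_le_one₀ (div_nonneg ha (by linarith)) ?_
      refine (div_le_self ha (by linarith)).trans (le_trans ?_ hb1)
      exact div_le_div_of_nonneg_right (max_le (by linarith) (by linarith)) hn0.le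
    · have := Real.add_one_le_exp (-(ζ * (max (x - δ) 0 / √(d n : ℝ) / (1 + lam n)) ^ 2))
      linarith

lemma eventually_oddsBound (hH : ∀ n, IsLinearTriples (H n) (S n) (d n))
    (hl : ∀ n, 0 < lam n) (hd : Tendsto d atTop atTop)
    (hlc : Tendsto (fun n => √(d n : ℝ) * lam n) atTop (nhds c)) (hc : 0 < c)
    (hζ : 0 ≤ ζ) (hζ1 : ζ < 1) (hζc : ζ * c ^ 2 < 1) (hx : x = c * Real.exp (-ζ * x ^ 2))
    {δ : ℝ} (hδ : 0 < δ) (k : ℕ) :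
    ∀ᶠ n in atTop, OddsBound (lam n) (H n) (S n) ζ k
      (max (x - δ) 0 / √(d n : ℝ)) ((x + δ) / √(d n : ℝ)) := by
  have hx0 : 0 < x := hx ▸ mul_pos hc (Real.exp_pos _)
  have hxc : x ≤ c := by
    rw [hx]
    exact mul_le_of_le_one_right hc.le (Real.exp_le_one_iff.2 (by nlinarith [sq_nonneg x]))
  have hs : Tendsto (fun n => √(d n : ℝ)) atTop atTop :=
    Real.tendsto_sqrt_atTop.comp (tendsto_natCast_atTop_atTop.comp hd)
  have hL0 : 0 ≤ c * √ζ := by positivity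
  have hL1 : c * √ζ < 1 := by
    refine lt_of_pow_lt_pow_left₀ 2 one_pos.le ?_
    rw [mul_pow, Real.sq_sqrt hζ]
    linarith
  set L := (c * √ζ + 1) / 2 with hL
  have hiter : ∀ j k : ℕ, ∀ᶠ n in atTop, OddsBound (lam n) (H n) (S n) ζ k
      (max (x - L ^ j * (c + 1)) 0 / √(d n : ℝ)) ((x + L ^ j * (c + 1)) / √(d n : ℝ)) := by
    intro j
    have hLpos : 0 < L := by rw [hL]; linarith
    induction j with
    | zero =>
      intro k
      filter_upwards [hs.eventually_gt_atTop 0,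
        hlc.eventually (gt_mem_nhds (lt_add_one c))] with n hn0 hn
      refine (oddsBound_trivial (hl n)).mono ?_ ?_
      · rw [max_eq_right (by linarith)]
        simp
      · rw [le_div_iff₀ hn0]
        linarith
    | succ j ih =>
      intro k
      have hp : 0 < L ^ j * (c + 1) := by positivity
      refine eventually_oddsBound_step hH hl hd hlc hc hζ hζ1 hx hp.le ?_ ih k
      rw [show L ^ (j + 1) * (c + 1) = L * (L ^ j * (c + 1)) by ring]
      refine mul_lt_mul_of_pos_right ?_ hp
      rw [hL]; linarith
  obtain ⟨j, hj⟩ : ∃ j : ℕ, L ^ j * (c + 1) < δ := by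
    obtain ⟨j, hj⟩ := exists_pow_lt_of_lt_one (div_pos hδ (by linarith : 0 < c + 1))
      (by rw [hL]; linarith : L < 1)
    exact ⟨j, (lt_div_iff₀ (by linarith)).1 hj⟩
  filter_upwards [hiter j k, hs.eventually_gt_atTop 0] with n hn hn0
  refine hn.mono ?_ ?_
  · exact div_le_div_of_nonneg_right (max_le_max (by linarith) le_rfl) hn0.le
  · exact div_le_div_of_nonneg_right (by linarith) hn0.le

end Limits

/-- The interaction with a factor `1 - ζ` for each triple in `H`. -/
def tripleInteraction {V : Type*} [DecidableEq V] (H : Finset (Finset V)) (ζ : ℝ)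
    (T : Finset V) : ℝ :=
  if T ∈ H then 1 - ζ else 1

section TripleProb

variable {V : Type*} [DecidableEq V] {lam ζ : ℝ} {S τ : Finset V} {H : Finset (Finset V)}
  {d : ℕ} {a b : ℝ}

lemma isPerturbed_tripleInteraction (hζ : 0 ≤ ζ) (hζ1 : ζ < 1) :
    IsPerturbed H ζ ∅ (tripleInteraction H ζ) where
  pos T := by
    unfold tripleInteraction
    split_ifs <;> linarith
  le_one T := by
    unfold tripleInteraction
    split_ifs <;> linarith
  supp T _ _ h := ⟨T, by by_contra hT; simp [tripleInteraction, hT] at h, le_rfl, by simp⟩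
  exact_eq τ hτ _ := by simp [tripleInteraction, hτ]

lemma tripleProb_bounds (hH : IsLinearTriples H S d) (hl : 0 < lam)
    (hζ : 0 ≤ ζ) (hζ1 : ζ < 1) (ha : 0 ≤ a) (hb0 : 0 ≤ b) (hb1 : b ≤ 1)
    (hB : OddsBound lam H S ζ 2 a b) (hτ : τ ∈ H) :
    (1 - ζ) * (a / (1 + lam)) ^ 3 ≤ gasZIn lam (tripleInteraction H ζ) S τ /
        gasZ lam (tripleInteraction H ζ) S ∧
      gasZIn lam (tripleInteraction H ζ) S τ / gasZ lam (tripleInteraction H ζ) S ≤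
        (1 - ζ) * (b ^ 3 / (1 - ζ * b ^ 2)) := by
  set Φ := tripleInteraction H ζ with hΦ
  have hP : IsPerturbed H ζ ∅ Φ := isPerturbed_tripleInteraction hζ hζ1
  obtain ⟨e, heτ⟩ : τ.Nonempty := by
    rw [← Finset.card_pos, hH.card_eq τ hτ]
    norm_num
  have heS := hH.subset τ hτ heτ
  have he1 : Φ {e} = 1 := by
    have : ({e} : Finset V) ∉ H := fun h => by simpa using hH.card_eq _ h
    simp [hΦ, tripleInteraction, this]
  have hO := hB ∅ Φ e hP (by simp) (by simpa using heS) he1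
  rw [Finset.sdiff_empty] at hO
  set T := τ.erase e with hT
  have hTA : T ∉ ({T}ᶜ : Set (Finset V)) := by simp
  have hins : insert T ({T}ᶜ : Set (Finset V)) = Set.univ := by
    ext T'
    simp [em]
  have hpair := gasZIn_pair_bounds hH hl (k := 0) hB ha hP (by simp)
    (by simpa using heS) hτ heτ (by
      have : blocked H ∅ = ∅ := by
        rw [blocked, Finset.empty_union, Finset.filter_eq_empty_iff]
        rintro f - ⟨-, τ', hτ', hf, hsub⟩
        have h1 := Finset.card_le_card hsub
        rw [Finset.card_erase_of_mem hf, hH.card_eq τ' hτ'] at h1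
        simp at h1
      rw [this]
      exact Finset.disjoint_empty_right _) _ hTA
  rw [Finset.sdiff_empty] at hpair
  have hΦτ : Φ (insert e T) = 1 - ζ := by
    rw [hT, Finset.insert_erase heτ]
    exact hP.exact_eq τ hτ (Finset.disjoint_empty_right _)
  have hZu : gasZ lam (couple e Set.univ Φ) (S.erase e) =
      gasZ lam (couple e {T}ᶜ Φ) (S.erase e) -
        (1 - Φ (insert e T)) * gasZIn lam (couple e {T}ᶜ Φ) (S.erase e) T := by
    rw [← hins]
    exact gasZ_couple_insert hTA
  have hIu : gasZIn lam (couple e Set.univ Φ) (S.erase e) T =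
      Φ (insert e T) * gasZIn lam (couple e {T}ᶜ Φ) (S.erase e) T := by
    conv_lhs => rw [← hins]
    exact gasZIn_couple_insert hTA
  have hτI : gasZIn lam Φ S τ = lam * gasZIn lam (couple e Set.univ Φ) (S.erase e) T := by
    rw [← gasZIn_insert heS (Finset.notMem_erase e τ), Finset.insert_erase heτ]
  have hsing := gasZIn_singleton_eq hl hP.pos heS
  rw [gasZIn_singleton heS] at hsing
  rw [hΦτ] at hZu hIu
  rw [hIu] at hτI
  have hZ := gasZ_pos hl hP.pos S
  have hY := gasZ_pos hl (couple_pos hP.pos e ({T}ᶜ : Set (Finset V))) (S.erase e)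
  set Y := gasZ lam (couple e {T}ᶜ Φ) (S.erase e)
  set X := gasZIn lam (couple e {T}ᶜ Φ) (S.erase e) T
  set r := gasOdds lam Φ S e
  set Z := gasZ lam Φ S
  have hrl : r ≤ lam := gasOdds_le hl hP.pos hP.le_one
  have hlo : a / (1 + lam) ≤ r / (1 + r) :=
    div_le_div₀ (ha.trans hO.1) hO.1 (by linarith) (by linarith)
  have hup : r / (1 + r) ≤ b := (div_le_self (ha.trans hO.1) (by linarith)).trans hO.2
  rw [sub_sub_cancel] at hZu
  rw [hZu] at hsing
  have hα : 0 ≤ a / (1 + lam) := div_nonneg ha (by linarith)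
  have hX : 0 ≤ X := (mul_nonneg (sq_nonneg _) hY.le).trans hpair.1
  rw [hτI, le_div_iff₀ hZ, div_le_iff₀ hZ]
  constructor
  · have h1 : a / (1 + lam) * Z ≤ lam * Y := by
      have := mul_le_mul_of_nonneg_right hlo hZ.le
      rw [← hsing] at this
      nlinarith [mul_nonneg hl.le (mul_nonneg hζ hX)]
    have h2 := mul_le_mul_of_nonneg_left h1 (sq_nonneg (a / (1 + lam)))
    have h3 := mul_le_mul_of_nonneg_left hpair.1 hl.le
    have h4 : (a / (1 + lam)) ^ 3 * Z ≤ lam * X := by linarith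
    nlinarith [mul_le_mul_of_nonneg_left h4 (sub_nonneg.2 hζ1.le)]
  · have hbz : 0 < 1 - ζ * b ^ 2 := by
      nlinarith [pow_le_one₀ hb0 hb1 (n := 2), sq_nonneg b]
    have h1 : lam * (Y - ζ * X) ≤ b * Z := hsing ▸ mul_le_mul_of_nonneg_right hup hZ.le
    have h2 : lam * X * (1 - ζ * b ^ 2) ≤ b ^ 3 * Z := by
      have h3 := mul_le_mul_of_nonneg_left h1 (sq_nonneg b)
      have h4 := mul_le_mul_of_nonneg_left hpair.2 hl.le
      linarith
    have h5 : lam * X ≤ b ^ 3 / (1 - ζ * b ^ 2) * Z := by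
      rw [div_mul_eq_mul_div, le_div_iff₀ hbz]
      exact h2
    nlinarith [mul_le_mul_of_nonneg_left h5 (sub_nonneg.2 hζ1.le)]

end TripleProb

lemma eventually_tripleProb {d : ℕ → ℕ} {lam : ℕ → ℝ} {c ζ x : ℝ}
    {V : ℕ → Type*} [∀ n, DecidableEq (V n)] {H : (n : ℕ) → Finset (Finset (V n))}
    {S : (n : ℕ) → Finset (V n)} (hH : ∀ n, IsLinearTriples (H n) (S n) (d n))
    (hl : ∀ n, 0 < lam n) (hd : Tendsto d atTop atTop)
    (hlc : Tendsto (fun n => √(d n : ℝ) * lam n) atTop (nhds c)) (hc : 0 < c)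
    (hζ : 0 ≤ ζ) (hζ1 : ζ < 1) (hζc : ζ * c ^ 2 < 1) (hx : x = c * Real.exp (-ζ * x ^ 2))
    {ε : ℝ} (hε : 0 < ε) :
    ∀ᶠ n in atTop, ∀ τ ∈ H n, |√(d n : ℝ) ^ 3 *
      (gasZIn (lam n) (tripleInteraction (H n) ζ) (S n) τ /
        gasZ (lam n) (tripleInteraction (H n) ζ) (S n)) - (1 - ζ) * x ^ 3| ≤ ε := by
  have hx0 : 0 < x := hx ▸ mul_pos hc (Real.exp_pos _)
  have h0 := tendsto_zero_of_sqrt_mul hd hlc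
  have hs : Tendsto (fun n => √(d n : ℝ)) atTop atTop :=
    Real.tendsto_sqrt_atTop.comp (tendsto_natCast_atTop_atTop.comp hd)
  obtain ⟨δ, hδ, hδx, hδ1, hδ2⟩ : ∃ δ > 0, δ < x ∧ (1 - ζ) * x ^ 3 - ε < (1 - ζ) * (x - δ) ^ 3 ∧
      (1 - ζ) * (x + δ) ^ 3 < (1 - ζ) * x ^ 3 + ε := by
    have h1 : Tendsto (fun δ : ℝ => (1 - ζ) * (x - δ) ^ 3) (nhds 0) (nhds ((1 - ζ) * x ^ 3)) := by
      have : Continuous fun δ : ℝ => (1 - ζ) * (x - δ) ^ 3 := by fun_prop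
      simpa using this.tendsto 0
    have h2 : Tendsto (fun δ : ℝ => (1 - ζ) * (x + δ) ^ 3) (nhds 0) (nhds ((1 - ζ) * x ^ 3)) := by
      have : Continuous fun δ : ℝ => (1 - ζ) * (x + δ) ^ 3 := by fun_prop
      simpa using this.tendsto 0
    have h3 := ((h1.eventually (lt_mem_nhds (sub_lt_self _ hε))).and
      ((h2.eventually (gt_mem_nhds (lt_add_of_pos_right _ hε))).and (gt_mem_nhds hx0))).filter_mono
        (nhdsWithin_le_nhds (s := Set.Ioi 0))
    obtain ⟨δ, ⟨h4, h5, h6⟩, h7⟩ := (h3.and self_mem_nhdsWithin).exists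
    exact ⟨δ, h7, h6, h4, h5⟩
  have hlo : Tendsto (fun n => (1 - ζ) * ((x - δ) / (1 + lam n)) ^ 3) atTop
      (nhds ((1 - ζ) * (x - δ) ^ 3)) := by
    simpa using (((tendsto_const_nhds (x := x - δ)).div (h0.const_add 1)
      (by norm_num)).pow 3).const_mul (1 - ζ)
  have hhi : Tendsto (fun n => (1 - ζ) * ((x + δ) ^ 3 / (1 - ζ * ((x + δ) / √(d n : ℝ)) ^ 2)))
      atTop (nhds ((1 - ζ) * (x + δ) ^ 3)) := by
    have h1 := (((hs.const_div_atTop (x + δ)).pow 2).const_mul ζ).const_sub 1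
    simpa using ((tendsto_const_nhds (x := (x + δ) ^ 3)).div h1 (by norm_num)).const_mul (1 - ζ)
  filter_upwards [eventually_oddsBound hH hl hd hlc hc hζ hζ1 hζc hx hδ 2,
    hs.eventually_gt_atTop 0, hs.eventually_ge_atTop (x + δ), hlo.eventually (lt_mem_nhds hδ1),
    hhi.eventually (gt_mem_nhds hδ2)] with n hn hn0 hn1 h1 h2 τ hτ
  rw [max_eq_left (by linarith)] at hn
  obtain ⟨h3, h4⟩ := tripleProb_bounds (hH n) (hl n) hζ hζ1 (div_nonneg (by linarith) hn0.le)
    (div_nonneg (by linarith) hn0.le) ((div_le_one hn0).2 hn1) hn hτ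
  have h5 := mul_le_mul_of_nonneg_left h3 (pow_pos hn0 3).le
  have h6 := mul_le_mul_of_nonneg_left h4 (pow_pos hn0 3).le
  rw [show √(d n : ℝ) ^ 3 * ((1 - ζ) * ((x - δ) / √(d n : ℝ) / (1 + lam n)) ^ 3) =
    (1 - ζ) * ((x - δ) / (1 + lam n)) ^ 3 by field_simp] at h5
  rw [show √(d n : ℝ) ^ 3 * ((1 - ζ) * (((x + δ) / √(d n : ℝ)) ^ 3 /
    (1 - ζ * ((x + δ) / √(d n : ℝ)) ^ 2))) =
    (1 - ζ) * ((x + δ) ^ 3 / (1 - ζ * ((x + δ) / √(d n : ℝ)) ^ 2)) by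
      rw [div_pow (x + δ) _ 3]; field_simp] at h6
  rw [abs_le]
  constructor <;> linarith

section CompleteGraph

/-- The edges of the complete graph on the vertex set `t`. -/
def pairsIn {n : ℕ} (t : Finset (Fin n)) : Finset (Sym2 (Fin n)) :=
  t.offDiag.image fun q => s(q.1, q.2)

/-- The edge sets of the triangles of the complete graph on `Fin n`. -/
def triangleTriples (n : ℕ) : Finset (Finset (Sym2 (Fin n))) :=
  (Finset.powersetCard 3 Finset.univ).image pairsIn

/-- The edges of a labeled graph as a finite set. -/
def edges {n : ℕ} (G : SimpleGraph (Fin n)) : Finset (Sym2 (Fin n)) :=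
  Finset.univ.filter fun e => e ∈ G.edgeSet

variable {n : ℕ} {t t' : Finset (Fin n)} {a b : Fin n}

lemma mk_mem_pairsIn : s(a, b) ∈ pairsIn t ↔ a ∈ t ∧ b ∈ t ∧ a ≠ b := by
  simp only [pairsIn, Finset.mem_image, Finset.mem_offDiag, Prod.exists, Sym2.eq_iff]
  constructor
  · rintro ⟨u, v, ⟨hu, hv, huv⟩, ⟨rfl, rfl⟩ | ⟨rfl, rfl⟩⟩
    · exact ⟨hu, hv, huv⟩
    · exact ⟨hv, hu, huv.symm⟩
  · rintro ⟨ha, hb, hab⟩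
    exact ⟨a, b, ⟨ha, hb, hab⟩, Or.inl ⟨rfl, rfl⟩⟩

lemma card_pairsIn (t : Finset (Fin n)) : (pairsIn t).card = t.card.choose 2 :=
  Sym2.card_image_offDiag t

lemma pairsIn_inter (t t' : Finset (Fin n)) : pairsIn (t ∩ t') = pairsIn t ∩ pairsIn t' := by
  ext e
  induction e with
  | _ a b =>
    simp only [Finset.mem_inter, mk_mem_pairsIn]
    tauto

lemma pairsIn_mono (h : t ⊆ t') : pairsIn t ⊆ pairsIn t' :=
  Finset.image_subset_image (Finset.offDiag_mono h)

lemma eq_of_one_lt_card_pairsIn_inter (ht : t.card = 3) (ht' : t'.card = 3)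
    (h : 1 < (pairsIn t ∩ pairsIn t').card) : t = t' := by
  rw [← pairsIn_inter, card_pairsIn] at h
  have h3 : 3 ≤ (t ∩ t').card := by
    by_contra! h2
    interval_cases (t ∩ t').card <;> simp at h
  rw [← Finset.eq_of_subset_of_card_le Finset.inter_subset_left (ht.trans_le h3)]
  exact Finset.eq_of_subset_of_card_le Finset.inter_subset_right (ht'.trans_le h3)

lemma pairsIn_injOn :
    Set.InjOn pairsIn
      (↑(Finset.powersetCard 3 (Finset.univ : Finset (Fin n))) : Set (Finset (Fin n))) := by
  intro t ht t' ht' h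
  have ht := (Finset.mem_powersetCard.1 ht).2
  refine eq_of_one_lt_card_pairsIn_inter ht (Finset.mem_powersetCard.1 ht').2 ?_
  rw [← h, Finset.inter_self, card_pairsIn, ht]
  norm_num

lemma card_triangleTriples (n : ℕ) : (triangleTriples n).card = n.choose 3 := by
  rw [triangleTriples, Finset.card_image_of_injOn pairsIn_injOn, Finset.card_powersetCard,
    Finset.card_univ, Fintype.card_fin]

lemma isLinearTriples_triangleTriples (n : ℕ) :
    IsLinearTriples (triangleTriples n) (pairsIn Finset.univ) (n - 2) where
  card_eq τ hτ := by
    obtain ⟨t, ht, rfl⟩ := Finset.mem_image.1 hτ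
    rw [card_pairsIn, (Finset.mem_powersetCard.1 ht).2]
    norm_num
  subset τ hτ := by
    obtain ⟨t, ht, rfl⟩ := Finset.mem_image.1 hτ
    exact pairsIn_mono (Finset.subset_univ t)
  linear τ hτ τ' hτ' x hx y hy hx' hy' hxy := by
    obtain ⟨t, ht, rfl⟩ := Finset.mem_image.1 hτ
    obtain ⟨t', ht', rfl⟩ := Finset.mem_image.1 hτ'
    rw [eq_of_one_lt_card_pairsIn_inter (Finset.mem_powersetCard.1 ht).2
      (Finset.mem_powersetCard.1 ht').2]
    exact Finset.one_lt_card.2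
      ⟨x, Finset.mem_inter.2 ⟨hx, hx'⟩, y, Finset.mem_inter.2 ⟨hy, hy'⟩, hxy⟩
  degree x hx := by
    induction x with
    | _ a b =>
      have hab := (mk_mem_pairsIn.1 hx).2.2
      have hcard : (({a, b} : Finset (Fin n))ᶜ).card = n - 2 := by
        rw [Finset.card_compl, Finset.card_pair hab, Fintype.card_fin]
      rw [← hcard]
      symm
      have h3 : ∀ v ∈ ({a, b} : Finset (Fin n))ᶜ,
          insert v {a, b} ∈ Finset.powersetCard 3 (Finset.univ : Finset (Fin n)) := by
        intro v hv
        rw [Finset.mem_powersetCard, Finset.card_insert_of_notMem (Finset.mem_compl.1 hv),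
          Finset.card_pair hab]
        exact ⟨Finset.subset_univ _, rfl⟩
      refine Finset.card_bij (fun v _ => pairsIn (insert v {a, b})) ?_ ?_ ?_
      · intro v hv
        simp only [Finset.mem_filter, mk_mem_pairsIn]
        exact ⟨Finset.mem_image_of_mem _ (h3 v hv), by simp, by simp, hab⟩
      · intro v hv w hw h
        have h1 := pairsIn_injOn (h3 v hv) (h3 w hw) h
        have h2 : v ∈ insert w ({a, b} : Finset (Fin n)) := h1 ▸ Finset.mem_insert_self v _
        exact (Finset.mem_insert.1 h2).resolve_right (Finset.mem_compl.1 hv)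
      · intro τ hτ
        obtain ⟨hτ, hmem⟩ := Finset.mem_filter.1 hτ
        obtain ⟨t, ht, rfl⟩ := Finset.mem_image.1 hτ
        obtain ⟨ha, hb, -⟩ := mk_mem_pairsIn.1 hmem
        have hsub : {a, b} ⊆ t := Finset.insert_subset ha (Finset.singleton_subset_iff.2 hb)
        have h1 : (t \ {a, b}).card = 1 := by
          rw [Finset.card_sdiff_of_subset hsub, (Finset.mem_powersetCard.1 ht).2,
            Finset.card_pair hab]
        obtain ⟨v, hv⟩ := Finset.card_eq_one.1 h1
        have hv' : v ∈ t \ {a, b} := hv ▸ Finset.mem_singleton_self v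
        refine ⟨v, Finset.mem_compl.2 (Finset.mem_sdiff.1 hv').2, ?_⟩
        rw [Finset.insert_eq, ← hv, Finset.sdiff_union_of_subset hsub]

lemma edgeCount_eq_card_edges (G : SimpleGraph (Fin n)) : edgeCount G = (edges G).card := by
  rw [edgeCount, edges, Nat.card_eq_fintype_card, Fintype.card_subtype]

lemma edges_subset (G : SimpleGraph (Fin n)) : edges G ⊆ pairsIn Finset.univ := by
  intro e
  induction e with
  | _ a b =>
    simp only [edges, Finset.mem_filter, SimpleGraph.mem_edgeSet, mk_mem_pairsIn,
      Finset.mem_univ, true_and]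
    exact fun h => h.ne

lemma edgeCount_le (G : SimpleGraph (Fin n)) : edgeCount G ≤ n.choose 2 := by
  rw [edgeCount_eq_card_edges]
  have := Finset.card_le_card (edges_subset G)
  rwa [card_pairsIn, Finset.card_univ, Fintype.card_fin] at this

lemma isNClique_three_iff (G : SimpleGraph (Fin n)) :
    G.IsNClique 3 t ↔
      t ∈ Finset.powersetCard 3 (Finset.univ : Finset (Fin n)) ∧ pairsIn t ⊆ edges G := by
  rw [SimpleGraph.isNClique_iff, Finset.mem_powersetCard, and_comm]
  simp only [Finset.subset_univ, true_and]
  refine and_congr_right fun _ => ⟨fun h e => ?_, fun h a ha b hb hab => ?_⟩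
  · induction e with
    | _ a b =>
      simp only [edges, Finset.mem_filter, SimpleGraph.mem_edgeSet, mk_mem_pairsIn,
        Finset.mem_univ, true_and]
      exact fun ⟨ha, hb, hab⟩ => h ha hb hab
  · have := h (mk_mem_pairsIn.2 ⟨ha, hb, hab⟩)
    simpa [edges] using this

lemma triCount_eq_card (G : SimpleGraph (Fin n)) :
    triCount G = ((triangleTriples n).filter fun τ => τ ⊆ edges G).card := by
  rw [triCount, Nat.card_eq_fintype_card, Fintype.card_subtype, triangleTriples,
    Finset.filter_image, Finset.card_image_of_injOn (pairsIn_injOn.mono fun t ht =>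
      Finset.mem_coe.2 (Finset.mem_filter.1 ht).1)]
  congr 1
  ext t
  simp [isNClique_three_iff]

lemma gibbsWeight_eq_gasWeight (lam ζ : ℝ) (G : SimpleGraph (Fin n)) :
    gibbsWeight lam ζ G = gasWeight lam (tripleInteraction (triangleTriples n) ζ) (edges G) := by
  unfold gibbsWeight gasWeight tripleInteraction
  rw [edgeCount_eq_card_edges, triCount_eq_card, Finset.prod_ite, Finset.prod_const,
    Finset.prod_const_one, mul_one]
  congr 3
  ext τ
  simp [and_comm]

lemma sum_edges_eq (F : Finset (Sym2 (Fin n)) → ℝ) :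
    ∑ G : SimpleGraph (Fin n), F (edges G) = ∑ σ ∈ (pairsIn Finset.univ).powerset, F σ := by
  refine Finset.sum_bij' (fun G _ => edges G) (fun σ _ => SimpleGraph.fromEdgeSet (σ : Set _))
    ?_ ?_ ?_ ?_ ?_
  · exact fun G _ => Finset.mem_powerset.2 (edges_subset G)
  · exact fun σ _ => Finset.mem_univ _
  · intro G _
    simp [edges]
  · intro σ hσ
    ext e
    induction e with
    | _ a b =>
      have : s(a, b) ∈ σ → s(a, b) ∈ _ := fun h => Finset.mem_powerset.1 hσ h
      simp only [mk_mem_pairsIn, Finset.mem_univ, true_and] at this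
      simpa [edges] using this
  · exact fun _ _ => rfl

lemma Zfun_eq_gasZ (lam ζ : ℝ) :
    Zfun n lam ζ = gasZ lam (tripleInteraction (triangleTriples n) ζ) (pairsIn Finset.univ) := by
  unfold Zfun gasZ
  rw [← sum_edges_eq]
  exact Finset.sum_congr rfl fun G _ => gibbsWeight_eq_gasWeight lam ζ G

lemma gibbsExp_triCount_eq_sum (lam ζ : ℝ) :
    gibbsExp n lam ζ (fun G => (triCount G : ℝ)) =
      ∑ τ ∈ triangleTriples n,
        gasZIn lam (tripleInteraction (triangleTriples n) ζ) (pairsIn Finset.univ) τ /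
          gasZ lam (tripleInteraction (triangleTriples n) ζ) (pairsIn Finset.univ) := by
  unfold gibbsExp
  rw [Zfun_eq_gasZ, ← Finset.sum_div]
  congr 1
  simp only [triCount_eq_card, gibbsWeight_eq_gasWeight]
  rw [sum_edges_eq fun σ => (((triangleTriples n).filter fun τ => τ ⊆ σ).card : ℝ) *
    gasWeight lam (tripleInteraction (triangleTriples n) ζ) σ]
  simp only [gasZIn, Finset.sum_filter, Finset.card_filter, Nat.cast_sum, Finset.sum_mul]
  rw [Finset.sum_comm]
  refine Finset.sum_congr rfl fun τ _ => Finset.sum_congr rfl fun σ _ => ?_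
  split_ifs <;> simp

end CompleteGraph

lemma natCast_rpow_three_halves (n : ℕ) : (n : ℝ) ^ ((3 : ℝ) / 2) = √(n : ℝ) ^ 3 := by
  rw [Real.sqrt_eq_rpow, ← Real.rpow_natCast, ← Real.rpow_mul (Nat.cast_nonneg n)]
  norm_num

lemma tendsto_choose_div_pow (k : ℕ) :
    Tendsto (fun n : ℕ => (n.choose k : ℝ) / (n : ℝ) ^ k) atTop (nhds (1 / (k.factorial : ℝ))) := by
  have h : Tendsto (fun n : ℕ => (n : ℝ) * (1 / (n : ℝ))) atTop (nhds 1) := by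
    refine tendsto_const_nhds.congr' ?_
    filter_upwards [eventually_gt_atTop 0] with n hn
    have : (n : ℝ) ≠ 0 := by positivity
    field_simp
  have h1 := ProbabilityTheory.tendsto_choose_mul_pow_atTop k h
  simpa [div_eq_mul_inv] using h1

lemma tendsto_gibbsExp_triCount {lam : ℕ → ℝ} {c ζ x : ℝ} (hl : ∀ n, 0 < lam n)
    (hlc : Tendsto (fun n : ℕ => √(n : ℝ) * lam n) atTop (nhds c)) (hc : 0 < c)
    (hζ : 0 ≤ ζ) (hζ1 : ζ < 1) (hζc : ζ * c ^ 2 < 1) (hx : x = c * Real.exp (-ζ * x ^ 2)) :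
    Tendsto (fun n : ℕ => gibbsExp n (lam n) ζ (fun G => (triCount G : ℝ)) /
      (n : ℝ) ^ ((3 : ℝ) / 2)) atTop (nhds ((1 - ζ) * x ^ 3 / 6)) := by
  have hd : Tendsto (fun n : ℕ => n - 2) atTop atTop := tendsto_sub_atTop_nat 2
  have hratio : Tendsto (fun n : ℕ => √((n - 2 : ℕ) : ℝ) / √(n : ℝ)) atTop (nhds 1) := by
    have h1 : Tendsto (fun n : ℕ => (1 : ℝ) - 2 / (n : ℝ)) atTop (nhds 1) := by
      simpa using (tendsto_const_div_atTop_nhds_zero_nat (2 : ℝ)).const_sub 1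
    have h2 := (Real.continuous_sqrt.tendsto 1).comp h1
    rw [Real.sqrt_one] at h2
    refine h2.congr' ?_
    filter_upwards [eventually_ge_atTop 2] with n hn
    have hn0 : (n : ℝ) ≠ 0 := by positivity
    rw [Function.comp_apply, ← Real.sqrt_div' _ (Nat.cast_nonneg n), Nat.cast_sub hn, sub_div,
      div_self hn0, Nat.cast_ofNat]
  have hlc' : Tendsto (fun n : ℕ => √((n - 2 : ℕ) : ℝ) * lam n) atTop (nhds c) := by
    have h1 := hratio.mul hlc
    rw [one_mul] at h1
    refine h1.congr' ?_
    filter_upwards [eventually_gt_atTop 0] with n hn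
    have : √(n : ℝ) ≠ 0 := (Real.sqrt_pos.2 (by exact_mod_cast hn)).ne'
    field_simp
  set E : ℕ → ℝ := fun n => gibbsExp n (lam n) ζ (fun G => (triCount G : ℝ)) with hE
  have hA : Tendsto (fun n : ℕ => √((n - 2 : ℕ) : ℝ) ^ 3 * E n / (n.choose 3 : ℝ)) atTop
      (nhds ((1 - ζ) * x ^ 3)) := by
    rw [Metric.tendsto_nhds]
    intro ε hε
    filter_upwards [eventually_tripleProb isLinearTriples_triangleTriples hl hd hlc' hc hζ hζ1 hζc
      hx (half_pos hε), eventually_ge_atTop 3] with n hn hn3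
    have hN : (0 : ℝ) < n.choose 3 := by exact_mod_cast Nat.choose_pos hn3
    rw [Real.dist_eq, div_sub' hN.ne', abs_div, abs_of_pos hN, div_lt_iff₀ hN]
    have h1 : √((n - 2 : ℕ) : ℝ) ^ 3 * E n - n.choose 3 * ((1 - ζ) * x ^ 3) =
        ∑ τ ∈ triangleTriples n, (√((n - 2 : ℕ) : ℝ) ^ 3 *
          (gasZIn (lam n) (tripleInteraction (triangleTriples n) ζ) (pairsIn Finset.univ) τ /
          gasZ (lam n) (tripleInteraction (triangleTriples n) ζ) (pairsIn Finset.univ)) -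
            (1 - ζ) * x ^ 3) := by
      rw [Finset.sum_sub_distrib, Finset.sum_const, card_triangleTriples, nsmul_eq_mul,
        ← Finset.mul_sum, ← gibbsExp_triCount_eq_sum]
    rw [h1]
    refine (Finset.abs_sum_le_sum_abs _ _).trans_lt ((Finset.sum_le_sum hn).trans_lt ?_)
    rw [Finset.sum_const, card_triangleTriples, nsmul_eq_mul]
    nlinarith
  have h3 := (tendsto_choose_div_pow 3).div (hratio.pow 3) (by norm_num)
  have h4 := hA.mul h3
  rw [show (1 - ζ) * x ^ 3 / 6 = (1 - ζ) * x ^ 3 * (1 / ((Nat.factorial 3 : ℕ) : ℝ) / 1 ^ 3) by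
    norm_num [Nat.factorial]; ring]
  refine h4.congr' ?_
  filter_upwards [eventually_ge_atTop 3] with n hn
  have hN : (n.choose 3 : ℝ) ≠ 0 := by exact_mod_cast (Nat.choose_pos hn).ne'
  have hn0 : (0 : ℝ) < n := by positivity
  have hs : 0 < √(n : ℝ) := Real.sqrt_pos.2 hn0
  have hs' : 0 < √((n - 2 : ℕ) : ℝ) := Real.sqrt_pos.2 (by exact_mod_cast by omega)
  have h6 : (n : ℝ) ^ 3 = √(n : ℝ) ^ 3 * √(n : ℝ) ^ 3 := by
    rw [← mul_pow, Real.mul_self_sqrt hn0.le]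
  simp only [Pi.div_apply]
  rw [natCast_rpow_three_halves, h6]
  field_simp
  rfl

/-- The total weight `λ^{|G|}` of the graphs in `A`. -/
def edgeSum {n : ℕ} (lam : ℝ) (A : Set (SimpleGraph (Fin n))) : ℝ :=
  ∑ G : SimpleGraph (Fin n), if G ∈ A then lam ^ edgeCount G else 0

section Gibbs

variable {n : ℕ} {lam ζ ζ' ζ₁ ζ₂ s t : ℝ}

lemma erProb_eq_mul_edgeSum {p : ℝ} (hp : p < 1) (A : Set (SimpleGraph (Fin n))) :
    erProb n p A = (1 - p) ^ n.choose 2 * edgeSum (p / (1 - p)) A := by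
  unfold erProb edgeSum
  rw [Finset.mul_sum]
  refine Finset.sum_congr rfl fun G _ => ?_
  have h1 : (1 - p) ≠ 0 := by linarith
  split_ifs
  · rw [← Nat.add_sub_cancel' (edgeCount_le G), add_tsub_cancel_left, pow_add, div_pow]
    field_simp
  · simp

lemma triCount_bot : triCount (⊥ : SimpleGraph (Fin n)) = 0 := by
  rw [triCount_eq_card, Finset.card_eq_zero, Finset.filter_eq_empty_iff]
  intro τ hτ h
  have h0 : edges (⊥ : SimpleGraph (Fin n)) = ∅ := by simp [edges]
  have := (isLinearTriples_triangleTriples n).card_eq τ hτ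
  rw [h0, Finset.subset_empty] at h
  simp [h] at this

lemma edgeSum_lowerTail_pos (hl : 0 < lam) (ht : 0 ≤ t) :
    0 < edgeSum lam {G : SimpleGraph (Fin n) | (triCount G : ℝ) ≤ t} := by
  refine Finset.sum_pos' (fun G _ => ?_) ⟨⊥, Finset.mem_univ _, ?_⟩
  · split_ifs
    · exact (pow_pos hl _).le
    · exact le_rfl
  · rw [if_pos (by simpa [triCount_bot] using ht)]
    exact pow_pos hl _

lemma gibbsWeight_pos (hl : 0 < lam) (hζ : ζ < 1) (G : SimpleGraph (Fin n)) :
    0 < gibbsWeight lam ζ G :=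
  mul_pos (pow_pos hl _) (pow_pos (sub_pos.2 hζ) _)

lemma Zfun_pos (hl : 0 < lam) (hζ : ζ < 1) : 0 < Zfun n lam ζ :=
  Finset.sum_pos (fun G _ => gibbsWeight_pos hl hζ G) Finset.univ_nonempty

lemma gibbsWeight_eq_mul_exp (hζ : ζ < 1) (G : SimpleGraph (Fin n)) :
    gibbsWeight lam ζ G = lam ^ edgeCount G * Real.exp (Real.log (1 - ζ) * triCount G) := by
  rw [gibbsWeight, mul_comm (Real.log _), Real.exp_nat_mul, Real.exp_log (sub_pos.2 hζ)]

lemma gibbsWeight_change (hζ : ζ < 1) (hζ' : ζ' < 1) (G : SimpleGraph (Fin n)) :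
    gibbsWeight lam ζ' G = gibbsWeight lam ζ G *
      Real.exp ((Real.log (1 - ζ') - Real.log (1 - ζ)) * triCount G) := by
  rw [gibbsWeight_eq_mul_exp hζ, gibbsWeight_eq_mul_exp hζ', mul_assoc, ← Real.exp_add]
  ring_nf

/-- Jensen's inequality for the partition function. -/
lemma exp_mul_Zfun_le (hl : 0 < lam) (hζ : ζ < 1) (hζ' : ζ' < 1) :
    Real.exp ((Real.log (1 - ζ') - Real.log (1 - ζ)) *
      gibbsExp n lam ζ fun G => (triCount G : ℝ)) * Zfun n lam ζ ≤ Zfun n lam ζ' := by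
  set a := Real.log (1 - ζ') - Real.log (1 - ζ) with ha
  set E := gibbsExp n lam ζ fun G => (triCount G : ℝ) with hE
  have hEZ : ∑ G : SimpleGraph (Fin n), (triCount G : ℝ) * gibbsWeight lam ζ G =
      E * Zfun n lam ζ := by
    rw [hE, gibbsExp, div_mul_cancel₀ _ (Zfun_pos hl hζ).ne']
  calc Real.exp (a * E) * Zfun n lam ζ
      = ∑ G : SimpleGraph (Fin n),
          gibbsWeight lam ζ G * (Real.exp (a * E) * (a * (triCount G - E) + 1)) := by
        have : ∀ G : SimpleGraph (Fin n),
            gibbsWeight lam ζ G * (Real.exp (a * E) * (a * (triCount G - E) + 1)) =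
            Real.exp (a * E) * a * (triCount G * gibbsWeight lam ζ G) +
              Real.exp (a * E) * (1 - a * E) * gibbsWeight lam ζ G := fun G => by ring
        simp only [this, Finset.sum_add_distrib, ← Finset.mul_sum, hEZ]
        rw [Zfun]
        ring
    _ ≤ Zfun n lam ζ' := by
        refine Finset.sum_le_sum fun G _ => ?_
        rw [gibbsWeight_change hζ hζ']
        refine mul_le_mul_of_nonneg_left ?_ (gibbsWeight_pos hl hζ G).le
        rw [← ha, show a * (triCount G : ℝ) = a * E + a * (triCount G - E) by ring, Real.exp_add]
        exact mul_le_mul_of_nonneg_left (Real.add_one_le_exp _) (Real.exp_pos _).le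

lemma edgeSum_inter_lowerTail_le (hl : 0 < lam) (hζ0 : 0 ≤ ζ) (hζ : ζ < 1)
    (A : Set (SimpleGraph (Fin n))) :
    edgeSum lam (A ∩ {G | (triCount G : ℝ) ≤ t}) ≤
      Real.exp (-Real.log (1 - ζ) * t) * (gibbsProb n lam ζ A * Zfun n lam ζ) := by
  rw [gibbsProb, div_mul_cancel₀ _ (Zfun_pos hl hζ).ne', edgeSum, Finset.mul_sum]
  refine Finset.sum_le_sum fun G _ => ?_
  have hw := gibbsWeight_pos hl hζ G
  by_cases hA : G ∈ A
  · by_cases ht : (triCount G : ℝ) ≤ t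
    · rw [if_pos ⟨hA, ht⟩, if_pos hA, gibbsWeight_eq_mul_exp hζ, mul_left_comm, ← Real.exp_add]
      refine le_mul_of_one_le_right (pow_pos hl _).le (Real.one_le_exp ?_)
      have := Real.log_nonpos (sub_nonneg.2 hζ.le) (by linarith)
      nlinarith
    · rw [if_neg fun h => ht h.2, if_pos hA]
      positivity
  · rw [if_neg fun h => hA h.1, if_neg hA, mul_zero]

lemma gibbsProb_univ (hl : 0 < lam) (hζ : ζ < 1) : gibbsProb n lam ζ Set.univ = 1 := by
  simp only [gibbsProb, Set.mem_univ, if_true]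
  exact div_self (Zfun_pos hl hζ).ne'

lemma edgeSum_lowerTail_le (hl : 0 < lam) (hζ0 : 0 ≤ ζ) (hζ : ζ < 1) :
    edgeSum lam {G : SimpleGraph (Fin n) | (triCount G : ℝ) ≤ t} ≤
      Real.exp (-Real.log (1 - ζ) * t) * Zfun n lam ζ := by
  have := edgeSum_inter_lowerTail_le (n := n) (t := t) hl hζ0 hζ Set.univ
  rwa [Set.univ_inter, gibbsProb_univ hl hζ, one_mul] at this

/-- A lower bound for the lower tail in terms of the concentration of the triangle count under
the Gibbs measure. -/
lemma edgeSum_lowerTail_ge (hl : 0 < lam) (h1 : 0 ≤ ζ₁) (h12 : ζ₁ < ζ₂) (h2 : ζ₂ < 1)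
    (ht : 0 < t) :
    Real.exp (-Real.log (1 - ζ₁) * s) * Zfun n lam ζ₁ *
      (1 - (gibbsExp n lam ζ₁ fun G => (triCount G : ℝ)) / t -
        Real.exp ((Real.log (1 - ζ₁) - Real.log (1 - ζ₂)) *
          (s - gibbsExp n lam ζ₂ fun G => (triCount G : ℝ)))) ≤
      edgeSum lam {G : SimpleGraph (Fin n) | (triCount G : ℝ) ≤ t} := by
  have hζ₁ := h12.trans h2
  set a := Real.log (1 - ζ₁) - Real.log (1 - ζ₂) with ha
  have ha0 : 0 ≤ a := sub_nonneg.2 (Real.log_le_log (by linarith) (by linarith))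
  have hL : Real.log (1 - ζ₁) ≤ 0 := Real.log_nonpos (by linarith) (by linarith)
  set E₂ := gibbsExp n lam ζ₂ fun G => (triCount G : ℝ)
  have hJ : Real.exp (a * E₂) * Zfun n lam ζ₂ ≤ Zfun n lam ζ₁ := exp_mul_Zfun_le hl h2 hζ₁
  have hEZ : ∑ G : SimpleGraph (Fin n), (triCount G : ℝ) * gibbsWeight lam ζ₁ G =
      (gibbsExp n lam ζ₁ fun G => (triCount G : ℝ)) * Zfun n lam ζ₁ := by
    rw [gibbsExp, div_mul_cancel₀ _ (Zfun_pos hl hζ₁).ne']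
  set E₁ := gibbsExp n lam ζ₁ fun G => (triCount G : ℝ)
  have key : ∑ G : SimpleGraph (Fin n), Real.exp (-Real.log (1 - ζ₁) * s) *
      (gibbsWeight lam ζ₁ G - triCount G * gibbsWeight lam ζ₁ G / t -
        Real.exp (a * s) * gibbsWeight lam ζ₂ G) ≤
      edgeSum lam {G : SimpleGraph (Fin n) | (triCount G : ℝ) ≤ t} := by
    refine Finset.sum_le_sum fun G _ => ?_
    have hw1 := gibbsWeight_pos hl hζ₁ G
    have hw2 := gibbsWeight_pos hl h2 G
    have hX : (0 : ℝ) ≤ triCount G := Nat.cast_nonneg _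
    have hbase : Real.exp (-Real.log (1 - ζ₁) * s) * (gibbsWeight lam ζ₁ G -
        triCount G * gibbsWeight lam ζ₁ G / t - Real.exp (a * s) * gibbsWeight lam ζ₂ G) ≤
        Real.exp (-Real.log (1 - ζ₁) * s) * gibbsWeight lam ζ₁ G := by
      refine mul_le_mul_of_nonneg_left ?_ (Real.exp_pos _).le
      have : 0 ≤ triCount G * gibbsWeight lam ζ₁ G / t := by positivity
      have : 0 ≤ Real.exp (a * s) * gibbsWeight lam ζ₂ G := by positivity
      linarith
    by_cases hXt : (triCount G : ℝ) ≤ t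
    · rw [if_pos (by simpa using hXt)]
      by_cases hXs : s ≤ triCount G
      · refine hbase.trans ?_
        rw [gibbsWeight_eq_mul_exp hζ₁, mul_left_comm, ← Real.exp_add]
        refine mul_le_of_le_one_right (pow_pos hl _).le (Real.exp_le_one_iff.2 ?_)
        nlinarith
      · refine le_trans ?_ (pow_pos hl _).le
        refine mul_nonpos_of_nonneg_of_nonpos (Real.exp_pos _).le ?_
        have h3 : gibbsWeight lam ζ₁ G ≤ Real.exp (a * s) * gibbsWeight lam ζ₂ G := by
          rw [gibbsWeight_change h2 hζ₁, mul_comm]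
          refine mul_le_mul_of_nonneg_right (Real.exp_le_exp.2 ?_) hw2.le
          exact mul_le_mul_of_nonneg_left (not_le.1 hXs).le ha0
        have : 0 ≤ triCount G * gibbsWeight lam ζ₁ G / t := by positivity
        linarith
    · rw [if_neg (by simpa using hXt)]
      refine mul_nonpos_of_nonneg_of_nonpos (Real.exp_pos _).le ?_
      have h3 : gibbsWeight lam ζ₁ G ≤ triCount G * gibbsWeight lam ζ₁ G / t := by
        rw [le_div_iff₀ ht, mul_comm]
        exact mul_le_mul_of_nonneg_right (not_le.1 hXt).le hw1.le
      have : 0 ≤ Real.exp (a * s) * gibbsWeight lam ζ₂ G := by positivity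
      linarith
  refine le_trans ?_ key
  rw [← Finset.mul_sum, Finset.sum_sub_distrib, Finset.sum_sub_distrib, ← Finset.mul_sum,
    ← Finset.sum_div, hEZ, mul_assoc]
  refine mul_le_mul_of_nonneg_left ?_ (Real.exp_pos _).le
  change _ ≤ Zfun n lam ζ₁ - _ - Real.exp (a * s) * Zfun n lam ζ₂
  have h4 : Real.exp (a * s) * Zfun n lam ζ₂ ≤ Real.exp (a * (s - E₂)) * Zfun n lam ζ₁ := by
    rw [show a * s = a * (s - E₂) + a * E₂ by ring, Real.exp_add, mul_assoc]
    exact mul_le_mul_of_nonneg_left hJ (Real.exp_pos _).le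
  have h5 : Zfun n lam ζ₁ * (1 - E₁ / t - Real.exp (a * (s - E₂))) =
    Zfun n lam ζ₁ - E₁ * Zfun n lam ζ₁ / t - Real.exp (a * (s - E₂)) * Zfun n lam ζ₁ := by ring
  rw [h5]
  linarith

end Gibbs

lemma tendsto_rpow_three_halves :
    Tendsto (fun n : ℕ => (n : ℝ) ^ ((3 : ℝ) / 2)) atTop atTop :=
  (tendsto_rpow_atTop (by norm_num)).comp tendsto_natCast_atTop_atTop

lemma eventually_edgeSum_lowerTail_ge {lam t : ℕ → ℝ} {ζ m : ℝ} {M : ℝ → ℝ}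
    (hl : ∀ n, 0 < lam n) (hζ0 : 0 < ζ) (hζ1 : ζ < 1) (hm : 0 < m)
    (ht : Tendsto (fun n : ℕ => t n / (n : ℝ) ^ ((3 : ℝ) / 2)) atTop (nhds m))
    (hE : Tendsto (fun n : ℕ => gibbsExp n (lam n) ζ (fun G => (triCount G : ℝ)) /
      (n : ℝ) ^ ((3 : ℝ) / 2)) atTop (nhds m))
    (hM : ∀ᶠ ζ' in nhdsWithin ζ (Set.Ioi ζ), M ζ' < m ∧
      Tendsto (fun n : ℕ => gibbsExp n (lam n) ζ' (fun G => (triCount G : ℝ)) /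
        (n : ℝ) ^ ((3 : ℝ) / 2)) atTop (nhds (M ζ')))
    (hMc : Tendsto M (nhdsWithin ζ (Set.Ioi ζ)) (nhds m)) {ε : ℝ} (hε : 0 < ε) :
    ∀ᶠ n : ℕ in atTop, -Real.log (1 - ζ) * m +
        Real.log (Zfun n (lam n) ζ) / (n : ℝ) ^ ((3 : ℝ) / 2) - ε ≤
      Real.log (edgeSum (lam n) {G : SimpleGraph (Fin n) | (triCount G : ℝ) ≤ t n}) /
        (n : ℝ) ^ ((3 : ℝ) / 2) := by
  have hgt : ∀ᶠ ζ' in nhdsWithin ζ (Set.Ioi ζ), ζ < ζ' := self_mem_nhdsWithin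
  obtain ⟨ζ₂, ⟨hM2, hE2⟩, hζ2, hζ21, hε2⟩ : ∃ ζ₂, (M ζ₂ < m ∧
      Tendsto (fun n : ℕ => gibbsExp n (lam n) ζ₂ (fun G => (triCount G : ℝ)) /
        (n : ℝ) ^ ((3 : ℝ) / 2)) atTop (nhds (M ζ₂))) ∧ ζ < ζ₂ ∧ ζ₂ < 1 ∧
      -Real.log (1 - ζ₂) * (m - M ζ₂) < ε / 4 := by
    have h1 : Tendsto (fun ζ' => -Real.log (1 - ζ') * (m - M ζ')) (nhdsWithin ζ (Set.Ioi ζ))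
        (nhds 0) := by
      have h2 : ContinuousAt (fun ζ' => -Real.log (1 - ζ')) ζ := by
        have : 1 - ζ ≠ 0 := by linarith
        fun_prop (disch := assumption)
      have h3 := (h2.tendsto.mono_left (nhdsWithin_le_nhds (s := Set.Ioi ζ))).mul
        (hMc.const_sub m)
      simpa using h3
    obtain ⟨ζ₂, h2, h3, h4, h5⟩ := (hM.and (hgt.and
      (((gt_mem_nhds hζ1).filter_mono nhdsWithin_le_nhds).and
        (h1.eventually (gt_mem_nhds (show 0 < ε / 4 by linarith)))))).exists
    exact ⟨ζ₂, h2, h3, h4, h5⟩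
  obtain ⟨ζ₁, ⟨hM1, hE1⟩, hζ1', hζ12⟩ : ∃ ζ₁, (M ζ₁ < m ∧
      Tendsto (fun n : ℕ => gibbsExp n (lam n) ζ₁ (fun G => (triCount G : ℝ)) /
        (n : ℝ) ^ ((3 : ℝ) / 2)) atTop (nhds (M ζ₁))) ∧ ζ < ζ₁ ∧ ζ₁ < ζ₂ := by
    obtain ⟨ζ₁, h2, h3, h4⟩ := (hM.and (hgt.and
      ((gt_mem_nhds hζ2).filter_mono nhdsWithin_le_nhds))).exists
    exact ⟨ζ₁, h2, h3, h4⟩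
  set L := Real.log (1 - ζ) with hL
  set L₁ := Real.log (1 - ζ₁) with hL₁
  set L₂ := Real.log (1 - ζ₂) with hL₂
  have hL20 : L₂ < L₁ := Real.log_lt_log (by linarith) (by linarith)
  have hL10 : L₁ < 0 := Real.log_neg (by linarith) (by linarith)
  set N : ℕ → ℝ := fun n => (n : ℝ) ^ ((3 : ℝ) / 2) with hN
  have hNtop : Tendsto N atTop atTop := tendsto_rpow_three_halves
  set δ := ε / (4 * -L₂) with hδ
  have hδ0 : 0 < δ := div_pos hε (by linarith)
  have hδL : -L₂ * δ = ε / 4 := by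
    have : L₂ ≠ 0 := by linarith
    rw [hδ]
    field_simp
  set ρ := 1 - M ζ₁ / m with hρ
  have hρ0 : 0 < ρ := sub_pos.2 ((div_lt_one hm).2 hM1)
  have hexp : Tendsto (fun n : ℕ => Real.exp ((L₁ - L₂) * ((M ζ₂ - δ) * N n -
      gibbsExp n (lam n) ζ₂ fun G => (triCount G : ℝ)))) atTop (nhds 0) := by
    refine Real.tendsto_exp_atBot.comp ?_
    have h1 : Tendsto (fun n : ℕ => (L₁ - L₂) * (M ζ₂ - δ -
        gibbsExp n (lam n) ζ₂ (fun G => (triCount G : ℝ)) / N n)) atTop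
        (nhds ((L₁ - L₂) * (M ζ₂ - δ - M ζ₂))) := (hE2.const_sub _).const_mul _
    have h2 := h1.neg_mul_atTop (by nlinarith) hNtop
    refine h2.congr' ?_
    filter_upwards [hNtop.eventually_gt_atTop 0] with n hn
    field_simp
  have hρn : Tendsto (fun n : ℕ => 1 - (gibbsExp n (lam n) ζ₁ fun G => (triCount G : ℝ)) / t n -
      Real.exp ((L₁ - L₂) * ((M ζ₂ - δ) * N n -
        gibbsExp n (lam n) ζ₂ fun G => (triCount G : ℝ)))) atTop (nhds ρ) := by
    have h1 := ((hE1.div ht hm.ne').const_sub 1).sub hexp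
    rw [sub_zero] at h1
    refine h1.congr' ?_
    filter_upwards [hNtop.eventually_gt_atTop 0] with n hn
    simp only [Pi.div_apply]
    rw [div_div_div_cancel_right₀ hn.ne']
  have herr : Tendsto (fun n : ℕ => Real.log (ρ / 2) / N n) atTop (nhds 0) :=
    hNtop.const_div_atTop _
  have hEe : Tendsto (fun n : ℕ => (L₁ - L) *
      (gibbsExp n (lam n) ζ (fun G => (triCount G : ℝ)) / N n)) atTop (nhds ((L₁ - L) * m)) :=
    hE.const_mul _
  filter_upwards [hNtop.eventually_gt_atTop 0, hρn.eventually (lt_mem_nhds (half_lt_self hρ0)),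
    herr.eventually (lt_mem_nhds (show -(ε / 4) < 0 by linarith)),
    hEe.eventually (lt_mem_nhds (show (L₁ - L) * m - ε / 4 < (L₁ - L) * m by linarith)),
    ht.eventually (lt_mem_nhds hm)] with n hn h1 h2 h3 h4
  have htn : 0 < t n := by
    have := mul_pos h4 hn
    rwa [div_mul_cancel₀ _ hn.ne'] at this
  have hZ := Zfun_pos (n := n) (hl n) hζ1
  have h5 := edgeSum_lowerTail_ge (n := n) (s := (M ζ₂ - δ) * N n) (hl n)
    (hζ0.trans hζ1').le hζ12 hζ21 htn
  have h6 := exp_mul_Zfun_le (n := n) (hl n) hζ1 (hζ12.trans hζ21)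
  set E := gibbsExp n (lam n) ζ fun G => (triCount G : ℝ)
  have h7 : Real.exp (-L₁ * ((M ζ₂ - δ) * N n)) *
      (Real.exp ((L₁ - L) * E) * Zfun n (lam n) ζ) * (ρ / 2) ≤
      edgeSum (lam n) {G : SimpleGraph (Fin n) | (triCount G : ℝ) ≤ t n} := by
    refine le_trans ?_ h5
    refine mul_le_mul (mul_le_mul_of_nonneg_left h6 (Real.exp_pos _).le) h1.le (by linarith) ?_
    exact mul_nonneg (Real.exp_pos _).le (Zfun_pos (hl n) (hζ12.trans hζ21)).le
  have h8 := Real.log_le_log (by positivity) h7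
  rw [Real.log_mul (by positivity) (by positivity), Real.log_mul (by positivity) (by positivity),
    Real.log_mul (by positivity) (by positivity), Real.log_exp, Real.log_exp] at h8
  rw [le_div_iff₀ hn]
  refine le_trans ?_ h8
  have h9 : Real.log (ρ / 2) = Real.log (ρ / 2) / N n * N n := by field_simp
  have h10 : (L₁ - L) * E = (L₁ - L) * (E / N n) * N n := by field_simp
  rw [h9, h10]
  have h11 : (-L * m + Real.log (Zfun n (lam n) ζ) / N n - ε) * N n =
      (-L * m - ε) * N n + Real.log (Zfun n (lam n) ζ) := by field_simp; ring
  change (-L * m + Real.log (Zfun n (lam n) ζ) / N n - ε) * N n ≤ _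
  rw [h11]
  have h12 : -L₁ * (m - M ζ₂ + δ) ≤ ε / 2 := by
    have := mul_le_mul_of_nonneg_right (neg_le_neg hL20.le)
      (show 0 ≤ m - M ζ₂ + δ by linarith)
    linarith
  have h13 := mul_le_mul_of_nonneg_right h12 hn.le
  have h14 := mul_le_mul_of_nonneg_right h2.le hn.le
  have h15 := mul_le_mul_of_nonneg_right h3.le hn.le
  linarith

lemma tendsto_log_edgeSum_lowerTail {lam t : ℕ → ℝ} {ζ m : ℝ} {M : ℝ → ℝ}
    (hl : ∀ n, 0 < lam n) (hζ0 : 0 < ζ) (hζ1 : ζ < 1) (hm : 0 < m)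
    (ht : Tendsto (fun n : ℕ => t n / (n : ℝ) ^ ((3 : ℝ) / 2)) atTop (nhds m))
    (hE : Tendsto (fun n : ℕ => gibbsExp n (lam n) ζ (fun G => (triCount G : ℝ)) /
      (n : ℝ) ^ ((3 : ℝ) / 2)) atTop (nhds m))
    (hM : ∀ᶠ ζ' in nhdsWithin ζ (Set.Ioi ζ), M ζ' < m ∧
      Tendsto (fun n : ℕ => gibbsExp n (lam n) ζ' (fun G => (triCount G : ℝ)) /
        (n : ℝ) ^ ((3 : ℝ) / 2)) atTop (nhds (M ζ')))
    (hMc : Tendsto M (nhdsWithin ζ (Set.Ioi ζ)) (nhds m)) :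
    Tendsto (fun n : ℕ =>
      Real.log (edgeSum (lam n) {G : SimpleGraph (Fin n) | (triCount G : ℝ) ≤ t n}) /
        (n : ℝ) ^ ((3 : ℝ) / 2) - (-Real.log (1 - ζ) * m +
          Real.log (Zfun n (lam n) ζ) / (n : ℝ) ^ ((3 : ℝ) / 2))) atTop (nhds 0) := by
  rw [Metric.tendsto_nhds]
  intro ε hε
  have h0 := ht.const_mul (-Real.log (1 - ζ))
  filter_upwards [eventually_edgeSum_lowerTail_ge hl hζ0 hζ1 hm ht hE hM hMc (half_pos hε),
    tendsto_rpow_three_halves.eventually_gt_atTop 0, ht.eventually (lt_mem_nhds hm),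
    h0.eventually (gt_mem_nhds (lt_add_of_pos_right _ hε))] with n h1 hn h2 h3
  have htn : 0 < t n := by
    have := mul_pos h2 hn
    rwa [div_mul_cancel₀ _ hn.ne'] at this
  have h4 := Real.log_le_log (edgeSum_lowerTail_pos (hl n) htn.le)
    (edgeSum_lowerTail_le (n := n) (t := t n) (hl n) hζ0.le hζ1)
  rw [Real.log_mul (Real.exp_pos _).ne' (Zfun_pos (hl n) hζ1).ne', Real.log_exp] at h4
  have h5 := div_le_div_of_nonneg_right h4 hn.le
  rw [add_div, mul_div_assoc] at h5
  rw [Real.dist_eq, sub_zero, abs_lt]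
  constructor <;> linarith

lemma eventually_condLowerTail_le {lam t : ℕ → ℝ} {ζ m : ℝ}
    (hl : ∀ n, 0 < lam n) (hζ0 : 0 < ζ) (hζ1 : ζ < 1) (hm : 0 < m)
    (ht : Tendsto (fun n : ℕ => t n / (n : ℝ) ^ ((3 : ℝ) / 2)) atTop (nhds m))
    (hT : Tendsto (fun n : ℕ =>
      Real.log (edgeSum (lam n) {G : SimpleGraph (Fin n) | (triCount G : ℝ) ≤ t n}) /
        (n : ℝ) ^ ((3 : ℝ) / 2) - (-Real.log (1 - ζ) * m +
          Real.log (Zfun n (lam n) ζ) / (n : ℝ) ^ ((3 : ℝ) / 2))) atTop (nhds 0))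
    {ε : ℝ} (hε : 0 < ε) {A : (n : ℕ) → Set (SimpleGraph (Fin n))}
    (hA : ∀ n : ℕ, gibbsProb n (lam n) ζ (A n) ≤ Real.exp (-ε * (n : ℝ) ^ ((3 : ℝ) / 2))) :
    ∀ᶠ n : ℕ in atTop, edgeSum (lam n) (A n ∩ {G | (triCount G : ℝ) ≤ t n}) /
        edgeSum (lam n) {G : SimpleGraph (Fin n) | (triCount G : ℝ) ≤ t n} ≤
      Real.exp (-ε * (n : ℝ) ^ ((3 : ℝ) / 2) / 2) := by
  have h0 := ht.const_mul (-Real.log (1 - ζ))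
  filter_upwards [hT.eventually (lt_mem_nhds (show -(ε / 4) < 0 by linarith)),
    tendsto_rpow_three_halves.eventually_gt_atTop 0, ht.eventually (lt_mem_nhds hm),
    h0.eventually (gt_mem_nhds (lt_add_of_pos_right _ (show 0 < ε / 4 by linarith)))]
    with n h1 hn h2 h3
  set N := (n : ℝ) ^ ((3 : ℝ) / 2)
  set L := Real.log (1 - ζ)
  have htn : 0 < t n := by
    have := mul_pos h2 hn
    rwa [div_mul_cancel₀ _ hn.ne'] at this
  have hTp := edgeSum_lowerTail_pos (n := n) (hl n) htn.le
  have hZ := Zfun_pos (n := n) (hl n) hζ1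
  rw [div_le_iff₀ hTp]
  refine (edgeSum_inter_lowerTail_le (hl n) hζ0.le hζ1 (A n)).trans ?_
  calc Real.exp (-L * t n) * (gibbsProb n (lam n) ζ (A n) * Zfun n (lam n) ζ)
      ≤ Real.exp (-L * t n) * (Real.exp (-ε * N) * Zfun n (lam n) ζ) := by
        gcongr
        exact hA n
    _ = Real.exp (-L * t n + (-ε * N + Real.log (Zfun n (lam n) ζ))) := by
        rw [Real.exp_add, Real.exp_add, Real.exp_log hZ]
    _ ≤ Real.exp (-ε * N / 2 + Real.log (edgeSum (lam n)
          {G : SimpleGraph (Fin n) | (triCount G : ℝ) ≤ t n})) := by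
        refine Real.exp_le_exp.2 ?_
        set F := Real.log (Zfun n (lam n) ζ)
        set T := Real.log (edgeSum (lam n) {G : SimpleGraph (Fin n) | (triCount G : ℝ) ≤ t n})
        have e1 : F = F / N * N := by field_simp
        have e2 : T = T / N * N := by field_simp
        have e3 : -L * t n = -L * (t n / N) * N := by field_simp
        rw [e1, e2, e3]
        nlinarith
    _ = _ := by rw [Real.exp_add, Real.exp_log hTp]

section Lambert

variable {W : ℝ → ℝ}

lemma IsLambertW.mono (hW : IsLambertW W) {x y : ℝ} (hx : 0 ≤ x) (hxy : x ≤ y) : W x ≤ W y := by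
  obtain ⟨h1, h2, -⟩ := hW x hx
  obtain ⟨h3, h4, -⟩ := hW y (hx.trans hxy)
  by_contra! h
  have := mul_lt_mul'' h (Real.exp_lt_exp.2 h) h3 (Real.exp_pos _).le
  linarith

lemma IsLambertW.sub_le (hW : IsLambertW W) {x y : ℝ} (hx : 0 ≤ x) (hxy : x ≤ y) :
    W y - W x ≤ y - x := by
  obtain ⟨h1, h2, -⟩ := hW x hx
  obtain ⟨h3, h4, -⟩ := hW y (hx.trans hxy)
  have h5 := hW.mono hx hxy
  have h6 := Real.one_le_exp h3
  have h7 := Real.exp_le_exp.2 h5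
  nlinarith

lemma IsLambertW.div_eq (hW : IsLambertW W) {x : ℝ} (hx : 0 < x) :
    W x / x = Real.exp (-W x) := by
  obtain ⟨-, h2, -⟩ := hW x hx.le
  rw [Real.exp_neg, div_eq_iff hx.ne', inv_mul_eq_div,
    eq_div_iff (Real.exp_pos _).ne', h2]

lemma IsLambertW.div_rpow_eq (hW : IsLambertW W) {x : ℝ} (hx : 0 < x) :
    (W x / x) ^ ((3 : ℝ) / 2) = Real.exp (-W x / 2) ^ 3 := by
  rw [hW.div_eq hx, ← Real.exp_mul, ← Real.exp_nat_mul]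
  congr 1
  push_cast
  ring

lemma IsLambertW.fixedPoint (hW : IsLambertW W) (c : ℝ) {ζ : ℝ} (hζ : 0 ≤ ζ) :
    c * Real.exp (-W (2 * ζ * c ^ 2) / 2) =
      c * Real.exp (-ζ * (c * Real.exp (-W (2 * ζ * c ^ 2) / 2)) ^ 2) := by
  obtain ⟨-, h2, -⟩ := hW (2 * ζ * c ^ 2) (by positivity)
  set w := W (2 * ζ * c ^ 2)
  have h3 : Real.exp (-w / 2) ^ 2 = Real.exp (-w) := by
    rw [← Real.exp_nat_mul]
    congr 1
    push_cast
    ring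
  have h4 : Real.exp w * Real.exp (-w) = 1 := by rw [← Real.exp_add, add_neg_cancel, Real.exp_zero]
  congr 2
  rw [mul_pow, h3]
  linear_combination w / 2 * h4 - Real.exp (-w) / 2 * h2

/-- The asymptotic value of the expected number of triangles under the Gibbs measure, in units of
`n ^ (3 / 2)`. -/
def gibbsTriangleDensity (W : ℝ → ℝ) (c ζ : ℝ) : ℝ :=
  (1 - ζ) * (c * Real.exp (-W (2 * ζ * c ^ 2) / 2)) ^ 3 / 6

lemma IsLambertW.gibbsTriangleDensity_lt (hW : IsLambertW W) {c ζ ζ' : ℝ} (hc : 0 < c)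
    (hζ : 0 ≤ ζ) (h : ζ < ζ') (hζ' : ζ' < 1) :
    gibbsTriangleDensity W c ζ' < gibbsTriangleDensity W c ζ := by
  unfold gibbsTriangleDensity
  have h1 : W (2 * ζ * c ^ 2) ≤ W (2 * ζ' * c ^ 2) := hW.mono (by positivity) (by gcongr)
  have h2 : (c * Real.exp (-W (2 * ζ' * c ^ 2) / 2)) ^ 3 ≤
      (c * Real.exp (-W (2 * ζ * c ^ 2) / 2)) ^ 3 := by gcongr
  have h3 : 0 < (c * Real.exp (-W (2 * ζ * c ^ 2) / 2)) ^ 3 := by positivity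
  nlinarith

lemma IsLambertW.tendsto_gibbsTriangleDensity (hW : IsLambertW W) (c : ℝ) {ζ : ℝ} (hζ : 0 ≤ ζ) :
    Tendsto (gibbsTriangleDensity W c) (nhdsWithin ζ (Set.Ioi ζ))
      (nhds (gibbsTriangleDensity W c ζ)) := by
  have h1 : Tendsto (fun ζ' => W (2 * ζ' * c ^ 2)) (nhdsWithin ζ (Set.Ioi ζ))
      (nhds (W (2 * ζ * c ^ 2))) := by
    have h2 : Tendsto (fun ζ' => W (2 * ζ * c ^ 2) + (2 * ζ' * c ^ 2 - 2 * ζ * c ^ 2))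
        (nhdsWithin ζ (Set.Ioi ζ)) (nhds (W (2 * ζ * c ^ 2))) := by
      have h3 : Continuous fun ζ' => W (2 * ζ * c ^ 2) + (2 * ζ' * c ^ 2 - 2 * ζ * c ^ 2) := by
        fun_prop
      have h4 := (h3.tendsto ζ).mono_left (nhdsWithin_le_nhds (s := Set.Ioi ζ))
      simpa using h4
    refine tendsto_of_tendsto_of_tendsto_of_le_of_le' tendsto_const_nhds h2 ?_ ?_
    · filter_upwards [self_mem_nhdsWithin] with ζ' hζ'
      have : ζ ≤ ζ' := le_of_lt hζ'
      exact hW.mono (by positivity) (by gcongr)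
    · filter_upwards [self_mem_nhdsWithin] with ζ' hζ'
      have : ζ ≤ ζ' := le_of_lt hζ'
      have := hW.sub_le (x := 2 * ζ * c ^ 2) (y := 2 * ζ' * c ^ 2) (by positivity) (by gcongr)
      linarith
  have h5 : Tendsto (fun ζ' : ℝ => 1 - ζ') (nhdsWithin ζ (Set.Ioi ζ)) (nhds (1 - ζ)) :=
    (tendsto_id.mono_left nhdsWithin_le_nhds).const_sub 1
  exact (h5.mul ((((Real.continuous_exp.tendsto _).comp
    (h1.neg.div_const 2)).const_mul c).pow 3)).div_const 6

lemma zetaLHS_eq (hW : IsLambertW W) {c ζ : ℝ} (hc : 0 < c) (hζ : 0 < ζ) :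
    zetaLHS W c ζ = (1 - ζ) * Real.exp (-W (2 * ζ * c ^ 2) / 2) ^ 3 := by
  rw [zetaLHS, if_neg hζ.ne', hW.div_rpow_eq (by positivity)]

lemma mul_sq_lt_one_of_ltCbar (hW : IsLambertW W) {c ζ : ℝ} (hc : 0 < c) (hζ : 0 < ζ)
    (hζ1 : ζ < 1) (h : LtCbar W c (zetaLHS W c ζ)) : ζ * c ^ 2 < 1 := by
  have he := Real.exp_pos 1
  have he1 : 1 < Real.exp 1 := by simp
  by_contra! hcon
  have hstar : etaStar W = Real.exp (-W (2 / Real.exp 1) / 2) ^ 3 := hW.div_rpow_eq (by positivity)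
  have hpos : 0 < etaStar W := hstar ▸ by positivity
  have h1 : 2 / Real.exp 1 ≤ 2 * ζ * c ^ 2 := by
    rw [div_le_iff₀ he]
    nlinarith
  have h2 : zetaLHS W c ζ ≤ (1 - ζ) * etaStar W := by
    rw [zetaLHS_eq hW hc hζ, hstar]
    have := hW.mono (by positivity) h1
    have h3 : 0 ≤ 1 - ζ := by linarith
    gcongr
  have h4 := h (h2.trans_lt (by nlinarith))
  have h5 : zetaLHS W c ζ / etaStar W ≤ 1 - ζ := (div_le_iff₀ hpos).2 h2
  have h6 : 0 < Real.exp 1 * (1 - zetaLHS W c ζ / etaStar W) := mul_pos he (by linarith)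
  rw [lt_div_iff₀ (Real.sqrt_pos.2 h6)] at h4
  have h7 : (c * √(Real.exp 1 * (1 - zetaLHS W c ζ / etaStar W))) ^ 2 < 1 :=
    pow_lt_one₀ (by positivity) h4 (by norm_num)
  rw [mul_pow, Real.sq_sqrt h6.le] at h7
  have h8 : Real.exp 1 * ζ ≤ Real.exp 1 * (1 - zetaLHS W c ζ / etaStar W) :=
    mul_le_mul_of_nonneg_left (by linarith) he.le
  nlinarith [mul_le_mul_of_nonneg_left h8 (sq_nonneg c)]

end Lambert

lemma tendsto_of_tendsto_sqrt_mul {p : ℕ → ℝ} {c : ℝ}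
    (h : Tendsto (fun n : ℕ => √(n : ℝ) * p n) atTop (nhds c)) : Tendsto p atTop (nhds 0) :=
  tendsto_zero_of_sqrt_mul (d := fun n => n) tendsto_id h

lemma tendsto_sqrt_mul_odds {p : ℕ → ℝ} {c : ℝ}
    (h : Tendsto (fun n : ℕ => √(n : ℝ) * p n) atTop (nhds c)) :
    Tendsto (fun n : ℕ => √(n : ℝ) * (p n / (1 - p n))) atTop (nhds c) := by
  have h1 := h.div ((tendsto_of_tendsto_sqrt_mul h).const_sub 1) (by norm_num)
  rw [sub_zero, div_one] at h1
  exact h1.congr fun n => mul_div_assoc _ _ _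

lemma tendsto_choose_two_mul_log {p : ℕ → ℝ} {c : ℝ} (hp : ∀ n, p n ∈ Set.Ioo (0 : ℝ) 1)
    (h : Tendsto (fun n : ℕ => √(n : ℝ) * p n) atTop (nhds c)) :
    Tendsto (fun n : ℕ => (n.choose 2 : ℝ) * Real.log (1 - p n) / (n : ℝ) ^ ((3 : ℝ) / 2)) atTop
      (nhds (-(c / 2))) := by
  have h1 : Tendsto (fun n : ℕ => √(n : ℝ) * Real.log (1 - p n)) atTop (nhds (-c)) := by
    refine tendsto_of_tendsto_of_tendsto_of_le_of_le (tendsto_sqrt_mul_odds h).neg h.neg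
      (fun n => ?_) fun n => ?_
    · have hp1 : 0 < 1 - p n := sub_pos.2 (hp n).2
      have h2 := Real.one_sub_inv_le_log_of_pos hp1
      have h3 : 1 - (1 - p n)⁻¹ = -(p n / (1 - p n)) := by field_simp; ring
      rw [h3] at h2
      have := mul_le_mul_of_nonneg_left h2 (Real.sqrt_nonneg n)
      simpa using this
    · have hp1 : 0 < 1 - p n := sub_pos.2 (hp n).2
      have h2 := Real.log_le_sub_one_of_pos hp1
      have := mul_le_mul_of_nonneg_left h2 (Real.sqrt_nonneg n)
      simpa using this
  have h2 := (tendsto_choose_div_pow 2).mul h1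
  rw [show 1 / ((Nat.factorial 2 : ℕ) : ℝ) * -c = -(c / 2) by norm_num [Nat.factorial]; ring] at h2
  refine h2.congr' ?_
  filter_upwards [eventually_gt_atTop 0] with n hn
  have hn0 : (0 : ℝ) < n := by exact_mod_cast hn
  have hs := Real.sqrt_pos.2 hn0
  rw [natCast_rpow_three_halves, show (n : ℝ) ^ 2 = √(n : ℝ) ^ 3 * √(n : ℝ) by
    rw [← pow_succ, show √(n : ℝ) ^ (3 + 1) = (√(n : ℝ) ^ 2) ^ 2 by ring,
      Real.sq_sqrt hn0.le]]
  field_simp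

lemma tendsto_expected_triangles {p : ℕ → ℝ} {c : ℝ} (η : ℝ)
    (h : Tendsto (fun n : ℕ => √(n : ℝ) * p n) atTop (nhds c)) :
    Tendsto (fun n : ℕ => η * (n.choose 3 : ℝ) * p n ^ 3 / (n : ℝ) ^ ((3 : ℝ) / 2)) atTop
      (nhds (η * c ^ 3 / 6)) := by
  have h2 := ((tendsto_choose_div_pow 3).mul (h.pow 3)).const_mul η
  rw [show η * (1 / ((Nat.factorial 3 : ℕ) : ℝ) * c ^ 3) = η * c ^ 3 / 6 by
    norm_num [Nat.factorial]; ring] at h2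
  refine h2.congr' ?_
  filter_upwards [eventually_gt_atTop 0] with n hn
  have hn0 : (0 : ℝ) < n := by exact_mod_cast hn
  have hs := Real.sqrt_pos.2 hn0
  rw [natCast_rpow_three_halves, show (n : ℝ) ^ 3 = √(n : ℝ) ^ 3 * √(n : ℝ) ^ 3 by
    rw [← mul_pow, Real.mul_self_sqrt hn0.le]]
  field_simp

/-- **Lemma (the lower-tail probability via the partition function `Z(λ,ζ)`, and transfer
of rare events to the conditional measure).** -/
theorem lower_tail_via_partition_function
    (W : ℝ → ℝ) (hW : IsLambertW W)
    (c η : ℝ) (hc : 0 < c) (hη : η ∈ Set.Ioo (0 : ℝ) 1) (hcbar : LtCbar W c η)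
    (zeta : ℝ) (hzeta : zeta ∈ Set.Icc (0 : ℝ) 1) (hzetaEq : zetaLHS W c zeta = η)
    (p : ℕ → ℝ) (hp : ∀ n, p n ∈ Set.Ioo (0 : ℝ) 1)
    (hpc : Tendsto (fun n : ℕ => Real.sqrt n * p n) atTop (nhds c)) :
    Tendsto (fun n : ℕ =>
        Real.log (erProb n (p n)
            {G | (triCount G : ℝ) ≤ η * (n.choose 3 : ℝ) * p n ^ 3}) /
            (n : ℝ) ^ ((3 : ℝ) / 2) -
          (-(c / 2) - Real.log (1 - zeta) * η * c ^ 3 / 6 +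
            Real.log (Zfun n (p n / (1 - p n)) zeta) / (n : ℝ) ^ ((3 : ℝ) / 2)))
      atTop (nhds 0) ∧
    ∀ ε : ℝ, 0 < ε →
      ∀ E : (n : ℕ) → Set (SimpleGraph (Fin n)),
        (∀ n : ℕ, gibbsProb n (p n / (1 - p n)) zeta (E n) ≤
          Real.exp (-ε * (n : ℝ) ^ ((3 : ℝ) / 2))) →
        ∀ᶠ n : ℕ in atTop,
          erCondProb n (p n) (E n)
              {G | (triCount G : ℝ) ≤ η * (n.choose 3 : ℝ) * p n ^ 3} ≤
            Real.exp (-ε * (n : ℝ) ^ ((3 : ℝ) / 2) / 2) := by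
  have hζ0 : 0 < zeta := by
    refine lt_of_le_of_ne hzeta.1 fun h => ?_
    rw [← h, zetaLHS, if_pos rfl] at hzetaEq
    linarith [hη.2]
  have hζ1 : zeta < 1 := by
    refine lt_of_le_of_ne hzeta.2 fun h => ?_
    rw [h, zetaLHS, sub_self, zero_mul] at hzetaEq
    linarith [hη.1]
  have hζc : zeta * c ^ 2 < 1 := mul_sq_lt_one_of_ltCbar hW hc hζ0 hζ1 (hzetaEq ▸ hcbar)
  have hlam : ∀ n, 0 < p n / (1 - p n) := fun n => div_pos (hp n).1 (sub_pos.2 (hp n).2)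
  have hm : 0 < η * c ^ 3 / 6 := by have := hη.1; positivity
  have hmEq : gibbsTriangleDensity W c zeta = η * c ^ 3 / 6 := by
    rw [← hzetaEq, zetaLHS_eq hW hc hζ0, gibbsTriangleDensity]
    ring
  have hdens : ∀ ζ', 0 ≤ ζ' → ζ' < 1 → ζ' * c ^ 2 < 1 →
      Tendsto (fun n : ℕ => gibbsExp n (p n / (1 - p n)) ζ' (fun G => (triCount G : ℝ)) /
        (n : ℝ) ^ ((3 : ℝ) / 2)) atTop (nhds (gibbsTriangleDensity W c ζ')) := fun ζ' h0 h1 h2 =>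
    tendsto_gibbsExp_triCount hlam (tendsto_sqrt_mul_odds hpc) hc h0 h1 h2 (hW.fixedPoint c h0)
  have ht := tendsto_expected_triangles η hpc
  have hM : ∀ᶠ ζ' in nhdsWithin zeta (Set.Ioi zeta), gibbsTriangleDensity W c ζ' < η * c ^ 3 / 6 ∧
      Tendsto (fun n : ℕ => gibbsExp n (p n / (1 - p n)) ζ' (fun G => (triCount G : ℝ)) /
        (n : ℝ) ^ ((3 : ℝ) / 2)) atTop (nhds (gibbsTriangleDensity W c ζ')) := by
    have h1 : Tendsto (fun ζ' : ℝ => ζ' * c ^ 2) (nhds zeta) (nhds (zeta * c ^ 2)) :=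
      tendsto_id.mul_const _
    filter_upwards [self_mem_nhdsWithin, nhdsWithin_le_nhds (gt_mem_nhds hζ1),
      nhdsWithin_le_nhds (h1.eventually (gt_mem_nhds hζc))] with ζ' h2 h3 h4
    exact ⟨hmEq ▸ hW.gibbsTriangleDensity_lt hc hζ0.le h2 h3,
      hdens ζ' (hζ0.le.trans (le_of_lt h2)) h3 h4⟩
  have hT := tendsto_log_edgeSum_lowerTail hlam hζ0 hζ1 hm ht
    (hmEq ▸ hdens zeta hζ0.le hζ1 hζc) hM (hmEq ▸ hW.tendsto_gibbsTriangleDensity c hζ0.le)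
  have hpow : ∀ n : ℕ, 0 < (1 - p n) ^ n.choose 2 := fun n => pow_pos (sub_pos.2 (hp n).2) _
  constructor
  · have h1 := ((tendsto_choose_two_mul_log hp hpc).sub_const (-(c / 2))).add hT
    rw [sub_self, add_zero] at h1
    refine h1.congr fun n => ?_
    have ht0 : 0 ≤ η * (n.choose 3 : ℝ) * p n ^ 3 :=
      mul_nonneg (mul_nonneg hη.1.le (Nat.cast_nonneg _)) (pow_pos (hp n).1 3).le
    rw [erProb_eq_mul_edgeSum (hp n).2, Real.log_mul (hpow n).ne'
      (edgeSum_lowerTail_pos (hlam n) ht0).ne', Real.log_pow]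
    ring
  · intro ε hε E hE
    filter_upwards [eventually_condLowerTail_le hlam hζ0 hζ1 hm ht hT hε hE] with n hn
    rwa [erCondProb, erProb_eq_mul_edgeSum (hp n).2, erProb_eq_mul_edgeSum (hp n).2,
      mul_div_mul_left _ _ (hpow n).ne']
end
end
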